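/- arXiv:2509.18541 — 11 statements merged into one kernel-verified Lean document; each statement's English description precedes it below -/
import Mathlib

section
/- Let D be an irreflexive digraph with at least one vertex. If every vertex of D is a peak, then D is not strongly chordal. -/
def StrongOrdering {V : Type*} (A : V → V → Prop) (r : V → V → Prop) : Prop :=
  IsStrictTotalOrder V r ∧
    ∀ a b c d : V, r a b → r c d → A a c → A a d → A b c → A b d

def StronglyChordal {V : Type*} (A : V → V → Prop) : Prop :=
  ∃ r : V → V → Prop, StrongOrdering A r

/-- A vertex `v` is a peak if there are vertices `u`, `w` with arcs
`(u,v)`, `(v,w)` and `(u,w)`. -/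
def Peak {V : Type*} (A : V → V → Prop) (v : V) : Prop :=
  ∃ u w : V, A u v ∧ A v w ∧ A u w

/-- In an irreflexive (nonempty, finite) digraph, if every vertex is a peak,
then the digraph is not strongly chordal. -/
theorem stmt_1 {V : Type*} [Fintype V] [Nonempty V] (A : V → V → Prop)
    (hirr : ∀ v : V, ¬ A v v)
    (h : ∀ v : V, Peak A v) : ¬ StronglyChordal A := by
  rintro ⟨r, hr, hA⟩
  obtain ⟨v, -, hv⟩ := (Finite.wellFounded_of_trans_of_irrefl (Function.swap r)).has_min
    Set.univ Set.univ_nonempty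
  obtain ⟨u, w, huv, hvw, huw⟩ := h v
  have lt_of_ne : ∀ x, x ≠ v → r x v := fun x hx => by
    rcases trichotomous_of r x v with hlt | heq | hgt
    · exact hlt
    · exact absurd heq hx
    · exact absurd hgt (hv x trivial)
  refine hirr v (hA u v w v (lt_of_ne u ?_) (lt_of_ne w ?_) huw huv hvw)
  · rintro rfl
    exact hirr u huv
  · rintro rfl
    exact hirr w hvw
end

section
/- Let D be an irreflexive oriented graph and let v be a vertex of D. If any of the following conditions holds: (1) v has two in-neighbours or two out-neighbours in an induced directed cycle of D; (2) v has two out-neighbours different from the initial vertex in an induced directed path of D; (3) v has two in-neighbours different from the terminal vertex in an induced directed path of D; then v is not simple. -/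
def Simplicial {V : Type*} (A : V → V → Prop) (v : V) : Prop :=
  ∀ u w : V, A u v → A v w → A u w

def SimpleVertex {V : Type*} (A : V → V → Prop) (v : V) : Prop :=
  Simplicial A v ∧
    (∀ x y : V, A x v → A y v →
      (∀ z : V, A x z → A y z) ∨ (∀ z : V, A y z → A x z)) ∧
    (∀ x y : V, A v x → A v y →
      (∀ z : V, A z x → A z y) ∨ (∀ z : V, A z y → A z x))

/-- `c : Fin k → V` lists the vertices of an induced directed cycle: at least three
distinct vertices whose induced subdigraph has exactly the consecutive arcs
(cyclically). -/
def InducedDirCycle {V : Type*} (A : V → V → Prop) {k : ℕ} (c : Fin k → V) : Prop :=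
  3 ≤ k ∧ Function.Injective c ∧
    ∀ i j : Fin k, A (c i) (c j) ↔ j.val = (i.val + 1) % k

/-- `p : Fin k → V` lists the vertices of an induced directed path: distinct vertices
whose induced subdigraph has exactly the consecutive arcs. `p 0` is the initial vertex
and `p (k-1)` is the terminal vertex. -/
def InducedDirPath {V : Type*} (A : V → V → Prop) {k : ℕ} (p : Fin k → V) : Prop :=
  Function.Injective p ∧
    ∀ i j : Fin k, A (p i) (p j) ↔ j.val = i.val + 1

theorem SimpleVertex.adj_or_adj_of_in {V : Type*} {A : V → V → Prop} {v x y a b : V}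
    (hv : SimpleVertex A v) (hx : A x v) (hy : A y v) (ha : A x a) (hb : A y b) :
    A y a ∨ A x b :=
  (hv.2.1 x y hx hy).imp (fun h => h a ha) (fun h => h b hb)

theorem SimpleVertex.adj_or_adj_of_out {V : Type*} {A : V → V → Prop} {v x y a b : V}
    (hv : SimpleVertex A v) (hx : A v x) (hy : A v y) (ha : A a x) (hb : A b y) :
    A a y ∨ A b x :=
  (hv.2.2 x y hx hy).imp (fun h => h a ha) (fun h => h b hb)

theorem add_one_mod_injOn {k i j : ℕ} (hi : i < k) (hj : j < k)
    (h : (i + 1) % k = (j + 1) % k) : i = j :=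
  Nat.ModEq.eq_of_lt_of_lt (Nat.ModEq.add_right_cancel' 1 h) hi hj

theorem exists_add_one_mod_eq {k i : ℕ} (hi : i < k) : ∃ m < k, i = (m + 1) % k := by
  rcases i with _ | i
  · exact ⟨k - 1, by omega, by rw [Nat.sub_add_cancel hi, Nat.mod_self]⟩
  · exact ⟨i, by omega, (Nat.mod_eq_of_lt hi).symm⟩

/-- In an irreflexive oriented graph, a vertex `v` is not simple if it has
(1) two in-neighbours or two out-neighbours in an induced directed cycle, or
(2) two out-neighbours different from the initial vertex in an induced directed path, or
(3) two in-neighbours different from the terminal vertex in an induced directed path. -/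
theorem stmt_3 {V : Type*} (A : V → V → Prop)
    (hirr : ∀ w : V, ¬ A w w)
    (horient : ∀ a b : V, A a b → ¬ A b a)
    (v : V)
    (h :
      (∃ (k : ℕ) (c : Fin k → V), InducedDirCycle A c ∧
        ∃ i j : Fin k, i ≠ j ∧
          ((A (c i) v ∧ A (c j) v) ∨ (A v (c i) ∧ A v (c j)))) ∨
      (∃ (k : ℕ) (p : Fin k → V), InducedDirPath A p ∧
        ∃ i j : Fin k, i ≠ j ∧ i.val ≠ 0 ∧ j.val ≠ 0 ∧
          A v (p i) ∧ A v (p j)) ∨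
      (∃ (k : ℕ) (p : Fin k → V), InducedDirPath A p ∧
        ∃ i j : Fin k, i ≠ j ∧ i.val ≠ k - 1 ∧ j.val ≠ k - 1 ∧
          A (p i) v ∧ A (p j) v)) :
    ¬ SimpleVertex A v := by
  intro hv
  rcases h with ⟨k, c, ⟨-, -, hc⟩, i, j, hij, ⟨hi, hj⟩ | ⟨hi, hj⟩⟩ |
    ⟨k, p, ⟨-, hp⟩, i, j, hij, hi0, hj0, hi, hj⟩ | ⟨k, p, ⟨-, hp⟩, i, j, hij, hik, hjk, hi, hj⟩
  · have hk : 0 < k := i.pos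
    let a : Fin k := ⟨(i.val + 1) % k, Nat.mod_lt _ hk⟩
    let b : Fin k := ⟨(j.val + 1) % k, Nat.mod_lt _ hk⟩
    rcases hv.adj_or_adj_of_in hi hj ((hc i a).2 rfl) ((hc j b).2 rfl) with h | h
    · exact hij (Fin.ext (add_one_mod_injOn i.2 j.2 ((hc _ _).1 h)))
    · exact hij (Fin.ext (add_one_mod_injOn i.2 j.2 ((hc _ _).1 h).symm))
  · obtain ⟨a, hak, ha⟩ := exists_add_one_mod_eq i.2
    obtain ⟨b, hbk, hb⟩ := exists_add_one_mod_eq j.2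
    rcases hv.adj_or_adj_of_out hi hj ((hc ⟨a, hak⟩ i).2 ha) ((hc ⟨b, hbk⟩ j).2 hb) with h | h
    · exact hij (Fin.ext (ha.trans ((hc _ _).1 h).symm))
    · exact hij (Fin.ext (((hc _ _).1 h).trans hb.symm))
  · have ha := (hp ⟨i.val - 1, by omega⟩ i).2 (by simp only; omega)
    have hb := (hp ⟨j.val - 1, by omega⟩ j).2 (by simp only; omega)
    rcases hv.adj_or_adj_of_out hi hj ha hb with h | h <;>
      · have := (hp _ _).1 h
        simp only at this
        omega
  · have ha := (hp i ⟨i.val + 1, by omega⟩).2 rfl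
    have hb := (hp j ⟨j.val + 1, by omega⟩).2 rfl
    rcases hv.adj_or_adj_of_in hi hj ha hb with h | h <;>
      · have := (hp _ _).1 h
        simp only at this
        omega
end

section
/- A reflexive tournament T is strongly chordal if and only if it is a reflexive transitive tournament. -/
/-- A strong ordering of a reflexive tournament rules out a directed triangle whose first vertex
in the ordering is `x`. -/
theorem StrongOrdering.not_triangle_of_first {V : Type*} {A r : V → V → Prop}
    (h : StrongOrdering A r) (htour : ∀ u v : V, u ≠ v → (A u v ↔ ¬ A v u))
    (href : ∀ v : V, A v v) {x y z : V} (hxy : r x y) (hxz : r x z) (hyz : y ≠ z)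
    (axy : A x y) (ayz : A y z) (azx : A z x) : False :=
  (htour y z hyz).1 ayz (h.2 x z x y hxz hxy (href x) axy azx)

/-- A reflexive tournament with a strong ordering has no directed triangle. -/
theorem StrongOrdering.not_triangle {V : Type*} {A r : V → V → Prop}
    (h : StrongOrdering A r) (htour : ∀ u v : V, u ≠ v → (A u v ↔ ¬ A v u))
    (href : ∀ v : V, A v v) {x y z : V} (hxy : x ≠ y) (hyz : y ≠ z) (hzx : z ≠ x)
    (axy : A x y) (ayz : A y z) (azx : A z x) : False := by
  have := h.1
  rcases trichotomous_of r x y with rxy | e | ryx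
  · rcases trichotomous_of r x z with rxz | e | rzx
    · exact h.not_triangle_of_first htour href rxy rxz hyz axy ayz azx
    · exact hzx e.symm
    · exact h.not_triangle_of_first htour href rzx (trans_of r rzx rxy) hxy azx axy ayz
  · exact hxy e
  · rcases trichotomous_of r y z with ryz | e | rzy
    · exact h.not_triangle_of_first htour href ryz ryx hzx ayz azx axy
    · exact hyz e
    · exact h.not_triangle_of_first htour href (trans_of r rzy ryx) rzy hxy azx axy ayz

/-- A reflexive tournament is strongly chordal if and only if it is a reflexive
transitive tournament, i.e. its vertices admit a linear ordering in which every
earlier vertex dominates every later vertex. -/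
theorem stmt_5 {V : Type*} [Fintype V] (A : V → V → Prop)
    (htour : ∀ u v : V, u ≠ v → (A u v ↔ ¬ A v u))
    (href : ∀ v : V, A v v) :
    StronglyChordal A ↔
      ∃ r : V → V → Prop, IsStrictTotalOrder V r ∧ ∀ u v : V, r u v → A u v := by
  constructor
  · rintro ⟨r, hr⟩
    refine ⟨fun u v => u ≠ v ∧ A u v, ?_, fun u v h => h.2⟩
    refine { trichotomous := ?_, irrefl := fun u h => h.1 rfl, trans := ?_ }
    · intro u v huv hvu
      by_contra hne
      exact huv ⟨hne, (htour u v hne).2 fun avu => hvu ⟨Ne.symm hne, avu⟩⟩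
    · rintro u v w ⟨huv, auv⟩ ⟨hvw, avw⟩
      have huw : u ≠ w := by
        rintro rfl
        exact (htour u v huv).1 auv avw
      refine ⟨huw, (htour u w huw).2 fun awu => ?_⟩
      exact hr.not_triangle htour href huv hvw huw.symm auv avw awu
  · rintro ⟨r, hr, hA⟩
    refine ⟨r, hr, fun a b c d _ hcd _ _ hbc => hA b d ?_⟩
    rcases trichotomous_of r b c with rbc | rfl | rcb
    · exact trans_of r rbc hcd
    · exact hcd
    · have hne : b ≠ c := by
        rintro rfl
        exact irrefl_of r b rcb
      exact absurd (hA c b rcb) ((htour b c hne).1 hbc)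
end

section
/- Let T be an irreflexive strongly chordal tournament and let T' be the tournament obtained from T by adding a new irreflexive vertex that either dominates every vertex of T (a source) or is dominated by every vertex of T (a sink). Then T' is strongly chordal. -/
/-- The extension of a relation on `V` to `Option V` in which `none` comes last. -/
def noneLast {V : Type*} (r : V → V → Prop) : Option V → Option V → Prop
  | some u, some v => r u v
  | some _, none => True
  | none, _ => False

theorem isStrictTotalOrder_noneLast {V : Type*} {r : V → V → Prop}
    (hr : IsStrictTotalOrder V r) : IsStrictTotalOrder (Option V) (noneLast r) where
  irrefl
    | some u => irrefl_of r u
    | none => id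
  trans
    | some _, some _, some _, huv, hvw => trans_of r huv hvw
    | some _, some _, none, _, _ => trivial
    | some _, none, _, _, h => h.elim
    | none, _, _, h, _ => h.elim
  trichotomous
    | some u, some v, h, h' => by
      rcases trichotomous_of r u v with h1 | h1 | h1
      exacts [(h h1).elim, congrArg some h1, (h' h1).elim]
    | some _, none, h, _ => (h trivial).elim
    | none, some _, _, h => (h trivial).elim
    | none, none, _, _ => rfl

/-- Adding a new irreflexive source or sink (here the vertex `none` of `Option V`)
to an irreflexive strongly chordal tournament yields a strongly chordal tournament. -/
theorem stmt_6 {V : Type*} [Fintype V] (A : V → V → Prop)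
    (htour : ∀ u v : V, u ≠ v → (A u v ↔ ¬ A v u))
    (hirr : ∀ v : V, ¬ A v v)
    (hsc : StronglyChordal A)
    (B : Option V → Option V → Prop)
    (hB : ∀ u v : V, B (some u) (some v) ↔ A u v)
    (hloop : ¬ B none none)
    (hext : (∀ v : V, B none (some v) ∧ ¬ B (some v) none) ∨
            (∀ v : V, B (some v) none ∧ ¬ B none (some v))) :
    StronglyChordal B := by
  obtain ⟨r, hr, hA⟩ := hsc
  refine ⟨noneLast r, isStrictTotalOrder_noneLast hr, ?_⟩
  rintro (_ | a) (_ | b) (_ | c) (_ | d) <;> grind [noneLast]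
end

section
/- Let T be an irreflexive tournament. If T contains two arc-disjoint directed triangles, then T is not strongly chordal. -/
/-- `u → v → w → u` is a directed triangle on three distinct vertices. -/
def DirTriangle {V : Type*} (A : V → V → Prop) (u v w : V) : Prop :=
  u ≠ v ∧ v ≠ w ∧ w ≠ u ∧ A u v ∧ A v w ∧ A w u

namespace StrongOrdering

variable {V : Type*} {A r : V → V → Prop}

/-- Reversing all arcs preserves strong orderings. -/
theorem converse (hr : StrongOrdering A r) : StrongOrdering (fun a b => A b a) r :=
  ⟨hr.1, fun a b c d hab hcd hac had hbc => hr.2 c d a b hcd hab hac hbc had⟩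

/-- The largest of three vertices is not the middle vertex of a transitive triangle. -/
theorem not_middle_max (hr : StrongOrdering A r) (hirr : ∀ v, ¬ A v v) {i j k : V}
    (hij : r i j) (hkj : r k j) (h₁ : A i j) (h₂ : A j k) (h₃ : A i k) : False :=
  hirr j (hr.2 i j k j hij hkj h₃ h₁ h₂)

/-- Every out-neighbour of `u` below `u` dominates every in-neighbour of `u` below `u`. -/
theorem out_dominates_in (hr : StrongOrdering A r)
    (htour : ∀ u v : V, u ≠ v → (A u v ↔ ¬ A v u)) (hirr : ∀ v, ¬ A v v) {u o i : V}
    (ho : r o u) (hi : r i u) (huo : A u o) (hiu : A i u) : A o i := by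
  have hne : o ≠ i := by
    rintro rfl
    exact (htour u o (by rintro rfl; exact hirr _ huo)).1 huo hiu
  rw [htour o i hne]
  exact fun h => hr.not_middle_max hirr hi ho hiu huo h

/-- If `u` lies above a directed triangle contained in its out-neighbourhood, then no
in-neighbour of `u` lies below `u`. -/
theorem no_triangle_in_out (hr : StrongOrdering A r)
    (htour : ∀ u v : V, u ≠ v → (A u v ↔ ¬ A v u)) (hirr : ∀ v, ¬ A v v) {u i x y z : V}
    (hi : r i u) (hx : r x u) (hy : r y u) (hz : r z u) (hiu : A i u)
    (hux : A u x) (huy : A u y) (huz : A u z) (hxy : A x y) (hyz : A y z) (hzx : A z x) :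
    False := by
  have := hr.1
  have hui : ¬ A u i := (htour i u (by rintro rfl; exact hirr _ hiu)).1 hiu
  have hdom : ∀ o, r o u → A u o → A o i := fun o ho huo =>
    hr.out_dominates_in htour hirr ho hi huo hiu
  have hxi := hdom x hx hux
  have hyi := hdom y hy huy
  have hzi := hdom z hz huz
  have below : ∀ p q, r p u → A u q → A p q → A p i → A q i → r i q := by
    intro p q hp huq hpq hpi hqi
    rcases trichotomous_of r i q with h | rfl | h
    · exact h
    · exact (hirr _ hqi).elim
    · exact (hui (hr.2 p u q i hp h hpq hpi huq)).elim
  have desc : ∀ p q, r p u → A u q → A p q → A p i → A q i → r q p := by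
    intro p q hp huq hpq hpi hqi
    rcases trichotomous_of r p q with h | rfl | h
    · exact (hr.not_middle_max hirr h (below p q hp huq hpq hpi hqi) hpq hqi hpi).elim
    · exact (hirr _ hpq).elim
    · exact h
  have h₁ := desc x y hx huy hxy hxi hyi
  have h₂ := desc y z hy huz hyz hyi hzi
  have h₃ := desc z x hz hux hzx hzi hxi
  exact irrefl_of r x (trans_of r h₃ (trans_of r h₂ h₁))

/-- An arc between two out-neighbours of `u` puts every in-neighbour of `u`
below its tail. -/
theorem in_lt_out (hr : StrongOrdering A r)
    (htour : ∀ u v : V, u ≠ v → (A u v ↔ ¬ A v u)) (hirr : ∀ v, ¬ A v v) {u o o' i : V}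
    (ho : r o u) (ho' : r o' u) (hi : r i u) (huo : A u o) (huo' : A u o') (hiu : A i u)
    (hoo' : A o o') : r i o := by
  have := hr.1
  have hui : ¬ A u i := (htour i u (by rintro rfl; exact hirr _ hiu)).1 hiu
  have hoi := hr.out_dominates_in htour hirr ho hi huo hiu
  have hoi' := hr.out_dominates_in htour hirr ho' hi huo' hiu
  have hio' : r i o' := by
    rcases trichotomous_of r i o' with h | rfl | h
    · exact h
    · exact (hui huo').elim
    · exact (hui (hr.2 o u o' i ho h hoo' hoi huo')).elim
  rcases trichotomous_of r o o' with h | rfl | h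
  · exact (hr.not_middle_max hirr h hio' hoo' hoi' hoi).elim
  · exact (hirr _ hoo').elim
  · exact trans_of r hio' h

/-- Two out-neighbours and two in-neighbours of `u` cannot all lie below `u`. -/
theorem not_two_out_two_in (hr : StrongOrdering A r)
    (htour : ∀ u v : V, u ≠ v → (A u v ↔ ¬ A v u)) (hirr : ∀ v, ¬ A v v) {u o o' i i' : V}
    (ho : r o u) (ho' : r o' u) (hi : r i u) (hi' : r i' u) (huo : A u o) (huo' : A u o')
    (hiu : A i u) (hiu' : A i' u) (hoo' : o ≠ o') (hii' : i ≠ i') : False := by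
  have := hr.1
  wlog h₁ : A o o' generalizing o o'
  · exact this ho' ho huo' huo hoo'.symm ((htour _ _ hoo'.symm).2 h₁)
  wlog h₂ : A i' i generalizing i i'
  · exact this hi' hi hiu' hiu hii'.symm ((htour _ _ hii').2 h₂)
  have h₃ := hr.in_lt_out htour hirr ho ho' hi huo huo' hiu h₁
  have h₄ := hr.converse.in_lt_out (fun a b hab => htour b a hab.symm) hirr
    hi hi' ho hiu hiu' huo h₂
  exact irrefl_of r i (trans_of r h₃ h₄)

/-- No directed triangle is arc-disjoint from a directed triangle whose vertex `u` lies
weakly above all the vertices of both. -/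
theorem not_triangles_of_max (hr : StrongOrdering A r)
    (htour : ∀ u v : V, u ≠ v → (A u v ↔ ¬ A v u)) (hirr : ∀ v, ¬ A v v) {u v w x y z : V}
    (h₁ : DirTriangle A u v w) (h₂ : DirTriangle A x y z)
    (hd : ∀ p : V × V, p ∈ ({(u, v), (v, w), (w, u)} : Set (V × V)) →
      p ∉ ({(x, y), (y, z), (z, x)} : Set (V × V)))
    (hmax : ∀ t, t = v ∨ t = w ∨ t = x ∨ t = y ∨ t = z → t = u ∨ r t u) : False := by
  simp only [Set.mem_insert_iff, Set.mem_singleton_iff, not_or, forall_eq_or_imp, forall_eq,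
    Prod.mk.injEq, not_and] at hd
  obtain ⟨huv, hvw, hwu, auv, avw, awu⟩ := h₁
  obtain ⟨hxy, hyz, hzx, axy, ayz, azx⟩ := h₂
  have hv : r v u := (hmax v (by simp)).resolve_left huv.symm
  have hw : r w u := (hmax w (by simp)).resolve_left hwu
  have shared : ∀ {o i : V}, o ≠ u → i ≠ u → (o = u ∨ r o u) → (i = u ∨ r i u) →
      A u o → A i u → v ≠ o → w ≠ i → False := fun ho hi ho' hi' huo hiu hvo hwi =>
    hr.not_two_out_two_in htour hirr hv (ho'.resolve_left ho) hw (hi'.resolve_left hi)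
      auv huo awu hiu hvo hwi
  have mx := hmax x (by simp)
  have my := hmax y (by simp)
  have mz := hmax z (by simp)
  by_cases ex : x = u
  · subst ex
    exact shared hxy.symm hzx my mz axy azx (by grind) (by grind)
  by_cases ey : y = u
  · subst ey
    exact shared hyz.symm hxy mz mx ayz axy (by grind) (by grind)
  by_cases ez : z = u
  · subst ez
    exact shared hzx.symm hyz mx my azx ayz (by grind) (by grind)
  have rx := mx.resolve_left ex
  have ry := my.resolve_left ey
  have rz := mz.resolve_left ez
  have back : ∀ {p q : V}, r p u → r q u → q ≠ u → A p q → A u q → p ≠ u → p ≠ q →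
      A u p := by
    intro p q hp hq hqu hpq huq hpu hne
    by_contra h
    exact (htour p q hne).1 hpq
      (hr.out_dominates_in htour hirr hq hp huq ((htour p u hpu).2 h))
  have bx := back rx ry ey axy
  have bry := back ry rz ez ayz
  have bz := back rz rx ex azx
  by_cases hux : A u x
  · have huz := bz hux ez hzx
    have huy := bry huz ey hyz
    exact hr.no_triangle_in_out htour hirr hw rx ry rz awu hux huy huz axy ayz azx
  · have huy : ¬ A u y := fun h => hux (bx h ex hxy)
    have huz : ¬ A u z := fun h => huy (bry h ey hyz)
    exact hr.converse.no_triangle_in_out (fun a b hab => htour b a hab.symm) hirr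
      hv rx rz ry auv ((htour x u ex).2 hux) ((htour z u ez).2 huz) ((htour y u ey).2 huy)
      azx ayz axy

end StrongOrdering

theorem DirTriangle.rotate {V : Type*} {A : V → V → Prop} {u v w : V}
    (h : DirTriangle A u v w) : DirTriangle A v w u :=
  ⟨h.2.1, h.2.2.1, h.1, h.2.2.2.2.1, h.2.2.2.2.2, h.2.2.2.1⟩

/-- If an irreflexive tournament contains two arc-disjoint directed triangles,
then it is not strongly chordal. -/
theorem stmt_7 {V : Type*} [Fintype V] (A : V → V → Prop)
    (htour : ∀ u v : V, u ≠ v → (A u v ↔ ¬ A v u))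
    (hirr : ∀ v : V, ¬ A v v)
    (h : ∃ u v w x y z : V, DirTriangle A u v w ∧ DirTriangle A x y z ∧
      ({(u, v), (v, w), (w, u)} : Set (V × V)) ∩ {(x, y), (y, z), (z, x)} = ∅) :
    ¬ StronglyChordal A := by
  rintro ⟨r, hr⟩
  obtain ⟨u, v, w, x, y, z, h₁, h₂, hd⟩ := h
  have := hr.1
  have hd' : ∀ p : V × V, p ∈ ({(u, v), (v, w), (w, u)} : Set (V × V)) →
      p ∉ ({(x, y), (y, z), (z, x)} : Set (V × V)) := fun p hp hq =>
    (Set.mem_empty_iff_false p).1 (hd ▸ ⟨hp, hq⟩)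
  obtain ⟨m, hm, hmax⟩ : ∃ m ∈ ({u, v, w, x, y, z} : Set V),
      ∀ t ∈ ({u, v, w, x, y, z} : Set V), t = m ∨ r t m := by
    classical
    let _ : LinearOrder V := linearOrderOfSTO r
    obtain ⟨m, hm, hmax⟩ := Set.exists_max_image ({u, v, w, x, y, z} : Set V) id
      (Set.toFinite _) ⟨u, by simp⟩
    exact ⟨m, hm, fun t ht => (hmax t ht).eq_or_lt⟩
  simp only [Set.mem_insert_iff, Set.mem_singleton_iff] at hm hmax hd'
  rcases hm with rfl | rfl | rfl | rfl | rfl | rfl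
  · exact hr.not_triangles_of_max htour hirr h₁ h₂ (by simpa using hd') (by grind)
  · exact hr.not_triangles_of_max htour hirr h₁.rotate h₂
      (by simp only [Set.mem_insert_iff, Set.mem_singleton_iff]; grind) (by grind)
  · exact hr.not_triangles_of_max htour hirr h₁.rotate.rotate h₂
      (by simp only [Set.mem_insert_iff, Set.mem_singleton_iff]; grind) (by grind)
  · exact hr.not_triangles_of_max htour hirr h₂ h₁
      (by simp only [Set.mem_insert_iff, Set.mem_singleton_iff]; grind) (by grind)
  · exact hr.not_triangles_of_max htour hirr h₂.rotate h₁
      (by simp only [Set.mem_insert_iff, Set.mem_singleton_iff]; grind) (by grind)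
  · exact hr.not_triangles_of_max htour hirr h₂.rotate.rotate h₁
      (by simp only [Set.mem_insert_iff, Set.mem_singleton_iff]; grind) (by grind)
end

section
/- Let n ≥ 3 be an integer. An irreflexive tournament on n vertices is both strongly connected and strongly chordal if and only if it is isomorphic to TT*_n. -/
/-- The tournament `TT*_n` on `Fin n`: all arcs `i → j` for `i < j`, except that the
arc from `0` to `n-1` is reversed. -/
def TTstar (n : ℕ) : Fin n → Fin n → Prop := fun i j =>
  (i.val < j.val ∧ ¬ (i.val = 0 ∧ j.val = n - 1)) ∨ (i.val = n - 1 ∧ j.val = 0)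

/-- A tournament in which every vertex other than `u`, `w` is an out-neighbour of `u` and an
in-neighbour of `w`, in which `w → u`, and which is transitive away from `u` and `w`,
is isomorphic to `TT*_n`. -/
theorem exists_equiv_TTstar {V : Type*} [Fintype V] (n : ℕ) (hcard : Fintype.card V = n)
    (A : V → V → Prop)
    (htour : ∀ u v : V, u ≠ v → (A u v ↔ ¬ A v u))
    (hirr : ∀ v : V, ¬ A v v) (u w : V) (hwu : A w u)
    (hu : ∀ z, z ≠ u → z ≠ w → A u z) (hw : ∀ z, z ≠ u → z ≠ w → A z w)
    (htrans : ∀ a b c, a ≠ u → a ≠ w → b ≠ u → b ≠ w → c ≠ u → c ≠ w →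
      A a b → A b c → A a c) :
    ∃ e : V ≃ Fin n, ∀ u v : V, A u v ↔ TTstar n (e u) (e v) := by
  classical
  have huw : u ≠ w := by rintro rfl; exact hirr _ hwu
  have hnuw : ¬ A u w := fun h => (htour _ _ huw).1 h hwu
  let B : V → V → Prop := fun y z => (A y z ∧ ¬ (y = w ∧ z = u)) ∨ (y = u ∧ z = w)
  have hB : IsStrictTotalOrder V B :=
    { irrefl := by
        rintro a (⟨h, -⟩ | ⟨h, h'⟩)
        · exact hirr _ h
        · exact huw (h.symm.trans h')
      trichotomous := by
        intro a b h1 h2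
        by_contra hab
        have := htour a b hab
        simp only [B] at h1 h2
        grind
      trans := by
        intro a b c h1 h2
        simp only [B] at h1 h2 ⊢
        have h3 := htrans a b c
        by_cases hac : a = c
        · subst hac
          by_cases hab : a = b
          · subst hab; grind
          · have := htour a b hab
            grind
        have hu' : ∀ z, ¬ (z ≠ w ∧ A z u) := by
          rintro z ⟨hz, h⟩
          by_cases hzu : z = u
          · subst hzu; exact hirr _ h
          · exact (htour _ _ hzu).1 h (hu z hzu hz)
        have hw' : ∀ z, ¬ (z ≠ u ∧ A w z) := by
          rintro z ⟨hz, h⟩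
          by_cases hzw : z = w
          · subst hzw; exact hirr _ h
          · exact (htour _ _ hzw).1 (hw z hz hzw) h
        have := hu c
        have := hw a
        have := hu' a
        have := hu' b
        have := hw' c
        have := hw' b
        clear htour htrans hu hw hu' hw' hcard
        by_cases a = u <;> by_cases a = w <;> by_cases b = u <;> by_cases b = w <;>
          by_cases c = u <;> by_cases c = w <;> grind }
  let : LinearOrder V := linearOrderOfSTO B
  have hlt : ∀ a b : V, a < b ↔ B a b := fun a b => Iff.rfl
  let e := (Fintype.orderIsoFinOfCardEq V hcard).symm
  have hpos : 0 < n := hcard ▸ Fintype.card_pos_iff.2 ⟨u⟩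
  have he : ∀ a b : V, (e a).val < (e b).val ↔ B a b := fun a b => by
    rw [← hlt, ← Fin.lt_def, e.lt_iff_lt]
  have heu : (e u).val = 0 := by
    by_contra h
    have h1 : (e (e.symm ⟨0, hpos⟩)).val < (e u).val := by simp; omega
    rw [he] at h1
    rcases h1 with ⟨h1, h2⟩ | ⟨-, h2⟩
    · have h3 : e.symm ⟨0, hpos⟩ ≠ w := fun h => h2 ⟨h, rfl⟩
      have h4 : e.symm ⟨0, hpos⟩ ≠ u := fun h => by rw [h] at h1; exact hirr _ h1
      exact (htour _ _ h4).1 h1 (hu _ h4 h3)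
    · exact huw h2
  have hew : (e w).val = n - 1 := by
    by_contra h
    have hl := (e w).isLt
    have h1 : (e w).val < (e (e.symm ⟨n - 1, by omega⟩)).val := by simp; omega
    rw [he] at h1
    rcases h1 with ⟨h1, h2⟩ | ⟨h2, -⟩
    · have h3 : e.symm ⟨n - 1, by omega⟩ ≠ u := fun h => h2 ⟨rfl, h⟩
      have h4 : e.symm ⟨n - 1, by omega⟩ ≠ w := fun h => by rw [h] at h1; exact hirr _ h1
      exact (htour _ _ h4.symm).1 h1 (hw _ h3 h4)
    · exact huw h2.symm
  have hu0 : ∀ a, (e a).val = 0 ↔ a = u := fun a =>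
    ⟨fun h => e.injective (Fin.ext (h.trans heu.symm)), fun h => h ▸ heu⟩
  have hwn : ∀ a, (e a).val = n - 1 ↔ a = w := fun a =>
    ⟨fun h => e.injective (Fin.ext (h.trans hew.symm)), fun h => h ▸ hew⟩
  refine ⟨e.toEquiv, fun a b => ?_⟩
  change A a b ↔ ((e a).val < (e b).val ∧ ¬ ((e a).val = 0 ∧ (e b).val = n - 1)) ∨
    ((e a).val = n - 1 ∧ (e b).val = 0)
  rw [he, hu0, hwn, hu0, hwn]
  simp only [B]
  grind

/-- A strongly chordal irreflexive tournament in which every vertex has an in-neighbour and an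
out-neighbour is isomorphic to `TT*_n`. -/
theorem exists_equiv_TTstar_of_strongOrdering {V : Type*} [Fintype V] [LinearOrder V] [Nonempty V]
    (n : ℕ) (hcard : Fintype.card V = n) (A : V → V → Prop)
    (htour : ∀ u v : V, u ≠ v → (A u v ↔ ¬ A v u))
    (hirr : ∀ v : V, ¬ A v v)
    (hord : ∀ a b c d : V, a < b → c < d → A a c → A a d → A b c → A b d)
    (hin : ∀ v, ∃ y, A y v) (hout : ∀ v, ∃ y, A v y) :
    ∃ e : V ≃ Fin n, ∀ u v : V, A u v ↔ TTstar n (e u) (e v) := by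
  have hne : ∀ a b, A a b → a ≠ b := fun a b h hab => hirr b (hab ▸ h)
  have hasymm : ∀ a b, A a b → ¬ A b a := fun a b h => (htour a b (hne a b h)).1 h
  have hof : ∀ a b, a ≠ b → ¬ A b a → A a b := fun a b hab h => (htour a b hab).2 h
  obtain ⟨x, -, hx⟩ := Set.exists_min_image (Set.univ : Set V) id Set.finite_univ Set.univ_nonempty
  have hxlt : ∀ y, y ≠ x → x < y := fun y hy => lt_of_le_of_ne (hx y trivial) hy.symm
  have hIn : ∀ i j, A i x → A j x → i < j → ∀ l, A i l → A j l := by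
    intro i j hi hj hij l hil
    by_cases hl : l = x
    · exact hl ▸ hj
    · exact hord i j x l hij (hxlt l hl) hi hil hj
  have hOut : ∀ k l, A x k → A x l → k < l → ∀ i, A i k → A i l := by
    intro k l hk hl hkl i hik
    by_cases hi : i = x
    · exact hi ▸ hl
    · exact hord x i k l (hxlt i hi) hkl hk hl hik
  have hInA : ∀ i j, A i x → A j x → i < j → A j i := fun i j hi hj hij =>
    hof _ _ hij.ne' fun h => hirr _ (hIn i j hi hj hij j h)
  have hOutA : ∀ k l, A x k → A x l → k < l → A k l := fun k l hk hl hkl =>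
    hof _ _ hkl.ne fun h => hirr _ (hOut k l hk hl hkl l h)
  have hlt_of_In : ∀ i j, A i x → A j x → A j i → i < j := fun i j hi hj h =>
    lt_of_not_ge fun hji => (lt_or_eq_of_le hji).elim
      (fun h' => hasymm _ _ h (hInA j i hj hi h')) (fun h' => hne _ _ h h')
  have hlt_of_Out : ∀ k l, A x k → A x l → A k l → k < l := fun k l hk hl h =>
    lt_of_not_ge fun hlk => (lt_or_eq_of_le hlk).elim
      (fun h' => hasymm _ _ h (hOutA l k hl hk h')) (fun h' => hne _ _ h h'.symm)
  obtain ⟨a, ha, hamin⟩ := Set.exists_min_image {y | A y x} id (Set.toFinite _) (hin x)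
  obtain ⟨a', ha', hamax⟩ := Set.exists_max_image {y | A y x} id (Set.toFinite _) (hin x)
  obtain ⟨b, hb, hbmin⟩ := Set.exists_min_image {y | A x y} id (Set.toFinite _) (hout x)
  obtain ⟨b', hb', hbmax⟩ := Set.exists_max_image {y | A x y} id (Set.toFinite _) (hout x)
  simp only [Set.mem_ofPred_eq, id] at ha ha' hb hb' hamin hamax hbmin hbmax
  have hcov : ∀ y, y ≠ x → A y x ∨ A x y := fun y hy => by
    have := hof y x hy; tauto
  have hdisj : ∀ i k, A i x → A x k → i ≠ k := fun i k hi hk h => hasymm _ _ hi (h ▸ hk)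
  have hba' : A b a' := by
    obtain ⟨y, hy⟩ := hin a'
    have hyx : y ≠ x := by rintro rfl; exact hasymm _ _ hy ha'
    rcases hcov y hyx with h | h
    · exact absurd (hlt_of_In a' y ha' h hy) (hamax y h).not_gt
    · refine hof _ _ (hdisj _ _ ha' hb).symm fun h' => ?_
      rcases (hbmin y h).lt_or_eq with h'' | rfl
      · exact hasymm _ _ hy (hOut b y hb h h'' _ h')
      · exact hasymm _ _ hy h'
  have hbA : ∀ i, A i x → A b i := by
    intro i hi
    refine hof _ _ (hdisj _ _ hi hb).symm fun h' => ?_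
    rcases (hamax i hi).lt_or_eq with h'' | rfl
    · exact hasymm _ _ hba' (hIn i a' hi ha' h'' _ h')
    · exact hasymm _ _ hba' h'
  have hb'a : A b' a := by
    obtain ⟨y, hy⟩ := hout b'
    have hyx : y ≠ x := by rintro rfl; exact hasymm _ _ hy hb'
    rcases hcov y hyx with h | h
    · refine hof _ _ (hdisj _ _ ha hb').symm fun h' => ?_
      rcases (hamin y h).lt_or_eq with h'' | rfl
      · exact hasymm _ _ hy (hIn a y ha h h'' _ h')
      · exact hasymm _ _ hy h'
    · exact absurd (hlt_of_Out b' y hb' h hy) (hbmax y h).not_gt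
  have hAa : ∀ k, A x k → A k a := by
    intro k hk
    refine hof _ _ (hdisj _ _ ha hk).symm fun h' => ?_
    rcases (hbmax k hk).lt_or_eq with h'' | rfl
    · exact hasymm _ _ hb'a (hOut k b' hk hb' h'' _ h')
    · exact hasymm _ _ hb'a h'
  rcases (hbmin b' hb').lt_or_eq with hbb | hbb
  · rcases (hamin a' ha').lt_or_eq with haa | haa
    · exfalso
      have h1 : A b' a' := hord b b' a a' hbb haa (hbA a ha) hba' hb'a
      have h2 : b' < a' := by
        rcases lt_trichotomy a' b' with h | h | h
        · exact absurd (hord b b' a' b' hbb h hba' (hOutA b b' hb hb' hbb) h1) (hirr _)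
        · exact absurd h (hdisj _ _ ha' hb')
        · exact h
      exact hirr _ (hord b a' a a' (hbb.trans h2) haa (hbA a ha) hba' (hInA a a' ha ha' haa))
    · have hOutz : ∀ z, z ≠ x → z ≠ a → A x z := fun z hzx hza =>
        (hcov z hzx).resolve_left fun h =>
          hza (le_antisymm (haa ▸ hamax z h) (hamin z h))
      refine exists_equiv_TTstar n hcard A htour hirr x a ha hOutz
        (fun z h1 h2 => hAa z (hOutz z h1 h2)) ?_
      intro p q r hp hp' hq hq' hr hr' hpq hqr
      have hp := hOutz p hp hp'
      have hq := hOutz q hq hq'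
      have hr := hOutz r hr hr'
      exact hOutA p r hp hr ((hlt_of_Out _ _ hp hq hpq).trans (hlt_of_Out _ _ hq hr hqr))
  · have hInz : ∀ z, z ≠ b → z ≠ x → A z x := fun z hzb hzx =>
      (hcov z hzx).resolve_right fun h =>
        hzb (le_antisymm (hbb ▸ hbmax z h) (hbmin z h))
    refine exists_equiv_TTstar n hcard A htour hirr b x hb
      (fun z h1 h2 => hbA z (hInz z h1 h2)) hInz ?_
    intro p q r hp hp' hq hq' hr hr' hpq hqr
    have hp := hInz p hp hp'
    have hq := hInz q hq hq'
    have hr := hInz r hr hr'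
    exact hInA r p hr hp ((hlt_of_In _ _ hr hq hqr).trans (hlt_of_In _ _ hq hp hpq))

theorem TTstar_reflTransGen {n : ℕ} (hn : 3 ≤ n) (i j : Fin n) :
    Relation.ReflTransGen (TTstar n) i j := by
  have hlast : ∀ i : Fin n, 0 < i.val →
      Relation.ReflTransGen (TTstar n) i ⟨n - 1, by omega⟩ := by
    intro i hi
    by_cases h : i.val = n - 1
    · rw [show i = ⟨n - 1, by omega⟩ from Fin.ext h]
    · exact .single (Or.inl ⟨by simp only; omega, by omega⟩)
  have hcycle : TTstar n ⟨n - 1, by omega⟩ ⟨0, by omega⟩ := Or.inr ⟨rfl, rfl⟩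
  have hto : Relation.ReflTransGen (TTstar n) i ⟨0, by omega⟩ := by
    by_cases h : i.val = 0
    · rw [show i = ⟨0, by omega⟩ from Fin.ext h]
    · exact (hlast i (by omega)).tail hcycle
  refine hto.trans ?_
  by_cases h0 : j.val = 0
  · rw [show j = ⟨0, by omega⟩ from Fin.ext h0]
  by_cases h : j.val = n - 1
  · rw [show j = ⟨n - 1, by omega⟩ from Fin.ext h]
    exact .head (b := ⟨1, by omega⟩) (Or.inl ⟨by simp, by simp only; omega⟩)
      (hlast _ (by simp))
  · exact .single (Or.inl ⟨by simp only; omega, by omega⟩)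

theorem strongOrdering_TTstar (n : ℕ) : StrongOrdering (TTstar n) (fun i j => j < i) := by
  refine ⟨inferInstanceAs (IsStrictTotalOrder (Fin n) (· > ·)), ?_⟩
  intro a b c d hab hcd h1 h2 h3
  simp only [TTstar, Fin.lt_def] at *
  omega

/-- For `n ≥ 3`, an irreflexive tournament on `n` vertices is both strongly connected
and strongly chordal if and only if it is isomorphic to `TT*_n`. -/
theorem stmt_8 {V : Type*} [Fintype V] (n : ℕ) (hn : 3 ≤ n)
    (hcard : Fintype.card V = n)
    (A : V → V → Prop)
    (htour : ∀ u v : V, u ≠ v → (A u v ↔ ¬ A v u))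
    (hirr : ∀ v : V, ¬ A v v) :
    ((∀ u v : V, Relation.ReflTransGen A u v) ∧ StronglyChordal A) ↔
      ∃ e : V ≃ Fin n, ∀ u v : V, A u v ↔ TTstar n (e u) (e v) := by
  classical
  constructor
  · rintro ⟨hconn, r, hr, hord⟩
    let : LinearOrder V := linearOrderOfSTO r
    have : Nontrivial V := Fintype.one_lt_card_iff_nontrivial.1 (by omega)
    refine exists_equiv_TTstar_of_strongOrdering n hcard A htour hirr hord ?_ ?_
    · intro v
      obtain ⟨w, hw⟩ := exists_ne v
      rcases (hconn w v).cases_tail with h | ⟨y, -, hy⟩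
      · exact absurd h.symm hw
      · exact ⟨y, hy⟩
    · intro v
      obtain ⟨w, hw⟩ := exists_ne v
      rcases (hconn v w).cases_head with h | ⟨y, hy, -⟩
      · exact absurd h.symm hw
      · exact ⟨y, hy⟩
  · rintro ⟨e, he⟩
    obtain ⟨-, hord⟩ := strongOrdering_TTstar n
    refine ⟨fun u v => ?_, fun a b => e b < e a, ?_, fun a b c d hab hcd => ?_⟩
    · have := (TTstar_reflTransGen hn (e u) (e v)).lift e.symm
        (p := A) (fun a b h => (he _ _).2 (by simpa using h))
      simpa [Function.onFun] using this
    · exact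
        { irrefl := fun a => lt_irrefl (e a)
          trichotomous := fun a b h1 h2 =>
            e.injective (le_antisymm (not_lt.1 h1) (not_lt.1 h2))
          trans := fun a b c h1 h2 => lt_trans h2 h1 }
    · simp only [he]
      exact hord _ _ _ _ hab hcd
end

section
/- An irreflexive tournament is strongly chordal if and only if it is obtained from an irreflexive transitive tournament by reversing at most one arc. -/
/-- A tournament is obtained from a transitive tournament by reversing at most one arc:
there is a linear ordering of the vertices such that either all arcs go forward, or
exactly one pair `a` before `b` has the backward arc `(b,a)` while all other pairs
have their forward arc. -/
def ReverseAtMostOneArc {V : Type*} (A : V → V → Prop) : Prop :=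
  ∃ r : V → V → Prop, IsStrictTotalOrder V r ∧
    ((∀ u v : V, r u v → A u v) ∨
      ∃ a b : V, r a b ∧ A b a ∧
        ∀ u v : V, r u v → ¬ (u = a ∧ v = b) → A u v)

/-- A 3-cycle on `m, s, t`, in either direction, with the vertices listed in `r`-order. -/
def OrderedTriangle {V : Type*} (A r : V → V → Prop) (m s t : V) : Prop :=
  r m s ∧ r s t ∧ (A m s ∧ A s t ∧ A t m ∨ A m t ∧ A t s ∧ A s m)

namespace StrongOrdering

variable {V : Type*} {A r : V → V → Prop}

theorem exists_orderedTriangle (hr : IsStrictTotalOrder V r) (hirr : ∀ v : V, ¬ A v v)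
    {x y z : V} (hxy : A x y) (hyz : A y z) (hzx : A z x) :
    ∃ m s t, OrderedTriangle A r m s t ∧
      (m = x ∧ t = y ∨ m = y ∧ t = x ∨ m = y ∧ t = z ∨ m = z ∧ t = y ∨
        m = z ∧ t = x ∨ m = x ∧ t = z) := by
  have tri : ∀ a b, A a b → r a b ∨ r b a := fun a b hab => by
    rcases trichotomous_of r a b with h | h | h
    · exact .inl h
    · exact absurd (h ▸ hab) (hirr a)
    · exact .inr h
  have htrans : ∀ a b c, r a b → r b c → r a c := fun _ _ _ => hr.trans _ _ _
  have hi : ∀ a, ¬ r a a := hr.irrefl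
  unfold OrderedTriangle
  rcases tri _ _ hxy with h1 | h1 <;> rcases tri _ _ hyz with h2 | h2 <;>
    rcases tri _ _ hzx with h3 | h3
  · exact absurd (htrans _ _ _ (htrans _ _ _ h1 h2) h3) (hi x)
  · exact ⟨x, y, z, by tauto⟩
  · exact ⟨z, x, y, by tauto⟩
  · exact ⟨x, z, y, by tauto⟩
  · exact ⟨y, z, x, by tauto⟩
  · exact ⟨y, x, z, by tauto⟩
  · exact ⟨z, y, x, by tauto⟩
  · exact absurd (htrans _ _ _ (htrans _ _ _ h3 h2) h1) (hi x)

/-- The least vertex of a 3-cycle is the least vertex of a strong ordering. -/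
theorem not_lt_of_orderedTriangle (h : StrongOrdering A r)
    (htour : ∀ u v : V, u ≠ v → (A u v ↔ ¬ A v u)) (hirr : ∀ v : V, ¬ A v v)
    {m s t w : V} (hT : OrderedTriangle A r m s t) : ¬ r w m := by
  obtain ⟨hr, h⟩ := h
  have htrans : ∀ a b c, r a b → r b c → r a c := fun _ _ _ => hr.trans _ _ _
  have hi : ∀ a, ¬ r a a := hr.irrefl
  obtain ⟨h1, h2, hT⟩ := hT
  intro hw
  have h3 := htrans _ _ _ h1 h2
  have h4 := htrans _ _ _ hw h1
  have h5 := htrans _ _ _ hw h3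
  have hne : ∀ a b, r a b → a ≠ b := fun a b hab e => hr.irrefl b (e ▸ hab)
  have := hne w m hw
  have := hne w s h4
  have := hne w t h5
  grind

/-- The 3-cycles of a strongly ordered tournament have a common greatest vertex. -/
theorem not_lt_of_orderedTriangle_of_orderedTriangle (h : StrongOrdering A r)
    (htour : ∀ u v : V, u ≠ v → (A u v ↔ ¬ A v u)) (hirr : ∀ v : V, ¬ A v v)
    {m s t s' t' : V} (hT : OrderedTriangle A r m s t) (hT' : OrderedTriangle A r m s' t') :
    ¬ r t t' := by
  obtain ⟨hr, h⟩ := h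
  have htrans : ∀ a b c, r a b → r b c → r a c := fun _ _ _ => hr.trans _ _ _
  have hi : ∀ a, ¬ r a a := hr.irrefl
  have tri : ∀ a b, r a b ∨ a = b ∨ r b a := trichotomous_of r
  obtain ⟨h1, h2, hT⟩ := hT
  obtain ⟨h1', h2', hT'⟩ := hT'
  intro hw
  have h3 := htrans _ _ _ h1 h2
  have h4 := htrans _ _ _ h1' h2'
  have h5 := htrans _ _ _ h2 hw
  have hne : ∀ a b, r a b → a ≠ b := fun a b hab e => hr.irrefl b (e ▸ hab)
  have := hne m s h1
  have := hne s t h2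
  have := hne m t h3
  have := hne m s' h1'
  have := hne s' t' h2'
  have := hne m t' h4
  have := hne t t' hw
  have := hne s t' h5
  rcases tri t s' with h7 | h7 | h7
  · have := hne t s' h7
    have := hne s s' (htrans _ _ _ h2 h7)
    grind
  · subst h7
    grind
  · have := hne s' t h7
    rcases tri s s' with h6 | h6 | h6
    · have := hne s s' h6
      grind
    · subst h6
      grind
    · have := hne s' s h6
      grind

end StrongOrdering

/-- A tournament without 3-cycles, or with an arc lying on all of its 3-cycles, is transitive up to
the reversal of at most one arc. -/
theorem reverseAtMostOneArc_of_common_arc {V : Type*} {A : V → V → Prop}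
    (htour : ∀ u v : V, u ≠ v → (A u v ↔ ¬ A v u)) (hirr : ∀ v : V, ¬ A v v)
    {a b c : V} (hba : A b a) (hac : A a c) (hcb : A c b)
    (hall : ∀ x y z, A x y → A y z → A z x →
      x = b ∧ y = a ∨ y = b ∧ z = a ∨ z = b ∧ x = a) :
    ReverseAtMostOneArc A := by
  have hab : a ≠ b := fun h => hirr a (by rwa [← h] at hba)
  refine ⟨fun u v => (A u v ∧ ¬ (u = b ∧ v = a)) ∨ (u = a ∧ v = b), ?_, .inr ⟨a, b, ?_, hba, ?_⟩⟩
  · refine { trichotomous := ?_, irrefl := ?_, trans := ?_ }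
    · intro x y; grind
    · intro x; grind
    · intro x y z hxy hyz
      have key : ∀ m, ¬ (A b m ∧ A m a) := by
        rintro m ⟨h1, h2⟩
        have hmc : m ≠ c := by rintro rfl; exact (htour a m (by grind)).1 hac h2
        by_cases hAmc : A m c
        · have := hall m c b hAmc hcb h1
          grind
        · have := hall a c m hac ((htour c m hmc.symm).2 hAmc) h2
          grind
      have := hall x y z
      have := key x
      have := key y
      have := key z
      grind
  · exact .inr ⟨rfl, rfl⟩
  · rintro u v (h | h) h'
    · exact h.1
    · exact absurd h h'

theorem reverseAtMostOneArc_of_forall_not_cycle {V : Type*} {A : V → V → Prop}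
    (htour : ∀ u v : V, u ≠ v → (A u v ↔ ¬ A v u)) (hirr : ∀ v : V, ¬ A v v)
    (hnone : ∀ x y z, A x y → A y z → ¬ A z x) : ReverseAtMostOneArc A := by
  refine ⟨A, { trichotomous := ?_, irrefl := hirr, trans := ?_ }, .inl fun _ _ h => h⟩
  · intro x y; grind
  · intro x y z hxy hyz; grind

theorem StronglyChordal.reverseAtMostOneArc {V : Type*} {A : V → V → Prop}
    (htour : ∀ u v : V, u ≠ v → (A u v ↔ ¬ A v u)) (hirr : ∀ v : V, ¬ A v v)
    (hA : StronglyChordal A) : ReverseAtMostOneArc A := by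
  obtain ⟨r, h⟩ := hA
  by_cases hnone : ∀ x y z, A x y → A y z → ¬ A z x
  · exact reverseAtMostOneArc_of_forall_not_cycle htour hirr hnone
  push Not at hnone
  obtain ⟨x, y, z, hxy, hyz, hzx⟩ := hnone
  obtain ⟨m, s, t, hT, -⟩ := StrongOrdering.exists_orderedTriangle h.1 hirr hxy hyz hzx
  have huniq : ∀ m' s' t', OrderedTriangle A r m' s' t' → m' = m ∧ t' = t := by
    intro m' s' t' hT'
    have hm : m' = m := by
      rcases @trichotomous_of _ r h.1.toTrichotomous m' m with h' | h' | h'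
      · exact absurd h' (h.not_lt_of_orderedTriangle htour hirr hT)
      · exact h'
      · exact absurd h' (h.not_lt_of_orderedTriangle htour hirr hT')
    subst hm
    refine ⟨rfl, ?_⟩
    rcases @trichotomous_of _ r h.1.toTrichotomous t' t with h' | h' | h'
    · exact absurd h' (h.not_lt_of_orderedTriangle_of_orderedTriangle htour hirr hT' hT)
    · exact h'
    · exact absurd h' (h.not_lt_of_orderedTriangle_of_orderedTriangle htour hirr hT hT')
  have hmem : ∀ x y z, A x y → A y z → A z x →
      m = x ∧ t = y ∨ m = y ∧ t = x ∨ m = y ∧ t = z ∨ m = z ∧ t = y ∨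
        m = z ∧ t = x ∨ m = x ∧ t = z := by
    intro x y z h1 h2 h3
    obtain ⟨m', s', t', hT', hc⟩ := StrongOrdering.exists_orderedTriangle h.1 hirr h1 h2 h3
    obtain ⟨rfl, rfl⟩ := huniq _ _ _ hT'
    exact hc
  rcases hT.2.2 with ⟨h1, h2, h3⟩ | ⟨h1, h2, h3⟩
  · refine reverseAtMostOneArc_of_common_arc htour hirr h3 h1 h2 fun x y z k1 k2 k3 => ?_
    have := hmem x y z k1 k2 k3
    grind
  · refine reverseAtMostOneArc_of_common_arc htour hirr h1 h2 h3 fun x y z k1 k2 k3 => ?_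
    have := hmem x y z k1 k2 k3
    grind

/-- The ordering which lists the vertices from `a` on first, and then those before `a` in
reverse. -/
def rotateAt {V : Type*} (r : V → V → Prop) (a u v : V) : Prop :=
  (¬ r u a ∧ r v a) ∨ (¬ r u a ∧ ¬ r v a ∧ r u v) ∨ (r u a ∧ r v a ∧ r v u)

theorem isStrictTotalOrder_rotateAt {V : Type*} {r : V → V → Prop} (hr : IsStrictTotalOrder V r)
    (a : V) : IsStrictTotalOrder V (rotateAt r a) := by
  have htrans : ∀ a b c, r a b → r b c → r a c := fun _ _ _ => hr.trans _ _ _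
  have hi : ∀ a, ¬ r a a := hr.irrefl
  have tri : ∀ a b, r a b ∨ a = b ∨ r b a := trichotomous_of r
  unfold rotateAt
  refine { trichotomous := ?_, irrefl := ?_, trans := ?_ }
  · intro x y; have := tri x y; grind
  · intro x; grind
  · intro x y z; have := htrans x y z; have := htrans z y x; grind

theorem ReverseAtMostOneArc.stronglyChordal {V : Type*} {A : V → V → Prop}
    (htour : ∀ u v : V, u ≠ v → (A u v ↔ ¬ A v u)) (hirr : ∀ v : V, ¬ A v v)
    (hA : ReverseAtMostOneArc A) : StronglyChordal A := by
  obtain ⟨r, hr, hA⟩ := hA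
  have htrans : ∀ a b c, r a b → r b c → r a c := fun _ _ _ => hr.trans _ _ _
  have hi : ∀ a, ¬ r a a := hr.irrefl
  have tri : ∀ a b, r a b ∨ a = b ∨ r b a := trichotomous_of r
  rcases hA with hA | ⟨a, b, hab, hba, hA⟩
  · have hAr : ∀ u v, A u v ↔ r u v := fun u v => by
      have := tri u v
      have := hA u v
      have := hA v u
      grind
    refine ⟨r, hr, fun i j k l hij hkl _ _ hjk => ?_⟩
    rw [hAr] at *
    exact htrans _ _ _ hjk hkl
  · have hAr : ∀ u v, A u v ↔ (r u v ∧ ¬ (u = a ∧ v = b)) ∨ (u = b ∧ v = a) := fun u v => by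
      have := tri u v
      have := hA u v
      have := hA v u
      grind
    refine ⟨rotateAt r a, isStrictTotalOrder_rotateAt hr a, fun i j k l hij hkl hik hil hjk => ?_⟩
    rw [hAr] at *
    unfold rotateAt at *
    grind

/-- An irreflexive tournament is strongly chordal if and only if it is obtained from
a transitive tournament by reversing at most one arc. -/
theorem stmt_9 {V : Type*} [Fintype V] (A : V → V → Prop)
    (htour : ∀ u v : V, u ≠ v → (A u v ↔ ¬ A v u))
    (hirr : ∀ v : V, ¬ A v v) :
    StronglyChordal A ↔ ReverseAtMostOneArc A := by
  exact ⟨StronglyChordal.reverseAtMostOneArc htour hirr,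
    ReverseAtMostOneArc.stronglyChordal htour hirr⟩
end

section
/- Let D be the digraph obtained from an irreflexive tournament by deleting one arc (x,y). If x and y are not false twins in D and D contains two arc-disjoint directed triangles, then D is not strongly chordal. -/
/-- The order `<` witnesses the strong ordering condition for `A`. -/
def GammaFree {V : Type*} [LinearOrder V] (A : V → V → Prop) : Prop :=
  ∀ a b c d : V, a < b → c < d → A a c → A a d → A b c → A b d

/-- `a < b < c` span a directed triangle, in one of the two cyclic directions. -/
def SortedTriangle {V : Type*} [LinearOrder V] (A : V → V → Prop) (a b c : V) : Prop :=
  a < b ∧ b < c ∧ ((A a b ∧ A b c ∧ A c a) ∨ (A a c ∧ A c b ∧ A b a))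

/-- `u` and `v` are equal or adjacent. -/
def Linked {V : Type*} (A : V → V → Prop) (u v : V) : Prop :=
  u = v ∨ A u v ∨ A v u

namespace SortedTriangle

variable {V : Type*} [LinearOrder V] {A : V → V → Prop}

/-- A vertex linked to a directed triangle cannot lie below it. -/
theorem min_le (hG : GammaFree A) (hasymm : ∀ u v, A u v → ¬ A v u) {a b c d : V}
    (h : SortedTriangle A a b c) (ha : Linked A a d) (hb : Linked A b d)
    (hc : Linked A c d) : a ≤ d := by
  obtain ⟨hab, hbc, h⟩ := h
  have hac := hab.trans hbc
  have hirr : ∀ v, ¬ A v v := fun v hv => hasymm v v hv hv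
  unfold GammaFree at hG
  by_contra hd
  have hda : d < a := by order
  have hdb := hda.trans hab
  have hdc := hdb.trans hbc
  have ha' := ha.resolve_left hda.ne'
  have hb' := hb.resolve_left hdb.ne'
  have hc' := hc.resolve_left hdc.ne'
  grind

/-- A linked vertex between the extremes of a directed triangle can replace its middle vertex. -/
theorem replace_mid (hG : GammaFree A) (hasymm : ∀ u v, A u v → ¬ A v u) {a b c d : V}
    (h : SortedTriangle A a b c) (had : a < d) (hdc : d < c) (ha : Linked A a d)
    (hb : Linked A b d) (hc : Linked A c d) : SortedTriangle A a d c := by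
  rcases hb with rfl | hb
  · exact h
  replace ha := ha.resolve_left had.ne
  replace hc := hc.resolve_left hdc.ne'
  obtain ⟨hab, hbc, h⟩ := h
  refine ⟨had, hdc, ?_⟩
  have hac := hab.trans hbc
  have hirr : ∀ v, ¬ A v v := fun v hv => hasymm v v hv hv
  unfold GammaFree at hG
  have : b < d ∨ d < b := by grind
  grind

/-- Two fully linked directed triangles with the same minimum have the same maximum. -/
theorem max_eq (hG : GammaFree A) (hasymm : ∀ u v, A u v → ¬ A v u) {m b c b' c' : V}
    (h1 : SortedTriangle A m b c) (h2 : SortedTriangle A m b' c')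
    (hbb : Linked A b b') (hbc : Linked A b c') (hcb : Linked A c b')
    (hcc : Linked A c c') : c = c' := by
  obtain ⟨_, _, h1⟩ := h1
  obtain ⟨_, _, h2⟩ := h2
  have hirr : ∀ v, ¬ A v v := fun v hv => hasymm v v hv hv
  unfold GammaFree at hG
  unfold Linked at *
  have : m < c := by order
  have : m < c' := by order
  by_contra hne
  wlog h : c < c' generalizing b c b' c'
  · grind
  have : b < c' := by order
  rcases lt_trichotomy b b' with hb | hb | hb
  · rcases lt_trichotomy c b' with hb | hb | hb <;> grind
  · grind
  · have : b' < c := by order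
    grind

theorem false_of_mid_lt_mid (hG : GammaFree A) (hasymm : ∀ u v, A u v → ¬ A v u) {m x y p q : V}
    (h1 : SortedTriangle A m x p) (h2 : SortedTriangle A m q y)
    (h3 : SortedTriangle A m p y) (hpq : p < q)
    (hxy : ¬ A x y) (hyx : ¬ A y x) (hpq' : Linked A p q) (hxq : Linked A x q) : False := by
  have hirr : ∀ v, ¬ A v v := fun v hv => hasymm v v hv hv
  unfold GammaFree at hG
  obtain ⟨_, _, h1⟩ := h1
  obtain ⟨_, _, h2⟩ := h2
  obtain ⟨_, _, h3⟩ := h3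
  have : m < p := by order
  have : m < y := by order
  have : x < q := by order
  have : x < y := by order
  replace hpq' := hpq'.resolve_left hpq.ne
  replace hxq := hxq.resolve_left (by order)
  grind

/-- Of two directed triangles `m x p` and `m y q` with common minimum `m` and non-adjacent
`x`, `y`, the first cannot have `x` as its middle vertex. -/
theorem false_of_common_min (hG : GammaFree A) (hasymm : ∀ u v, A u v → ¬ A v u)
    {m x y p q : V} (h1 : SortedTriangle A m x p)
    (h2 : SortedTriangle A m y q ∨ SortedTriangle A m q y) (hpq : p ≠ q)
    (hxy : ¬ A x y) (hyx : ¬ A y x) (hL : Linked A p q) (hyp : Linked A y p)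
    (hxq : Linked A x q) : False := by
  rcases lt_or_gt_of_ne hpq with h | h
  · rcases h2 with h2 | h2
    · have h3 := h2.replace_mid hG hasymm (d := p) (by obtain ⟨_, _, _⟩ := h1; order) h
        (by grind [SortedTriangle, Linked]) hyp (by grind [Linked])
      exact hpq (h1.max_eq hG hasymm h3 (by grind [SortedTriangle, Linked]) hxq (.inl rfl) hL)
    · have h3 := h2.replace_mid hG hasymm (d := p) (by obtain ⟨_, _, _⟩ := h1; order)
        (by obtain ⟨_, _, _⟩ := h2; order)
        (by grind [SortedTriangle, Linked]) (by grind [Linked]) hyp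
      exact h1.false_of_mid_lt_mid hG hasymm h2 h3 h hxy hyx hL hxq
  · have h3 := h1.replace_mid hG hasymm (d := q)
        (by rcases h2 with ⟨_, _, _⟩ | ⟨_, _, _⟩ <;> order) h
        (by grind [SortedTriangle, Linked]) hxq hL
    rcases h2 with h2 | h2
    · exact hpq (h3.max_eq hG hasymm h2 (by grind [SortedTriangle, Linked]) (.inl rfl)
        (by grind [Linked]) hL)
    · have := h3.max_eq hG hasymm h2 (.inl rfl) (by grind [SortedTriangle, Linked]) hL
        (by grind [Linked])
      grind [SortedTriangle]

theorem twin_of_common_min_mid (hG : GammaFree A) (hasymm : ∀ u v, A u v → ¬ A v u)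
    {m x y p z : V} (h1 : SortedTriangle A m p x) (h2 : SortedTriangle A m p y) (hmz : m ≤ z)
    (hxy : ¬ A x y) (hyx : ¬ A y x) (hxz' : x ≠ z) (hyz' : y ≠ z)
    (hxz : Linked A x z) (hyz : Linked A y z) (hpz : Linked A p z) (hmz' : Linked A m z) :
    (A x z ↔ A y z) := by
  have hirr : ∀ v, ¬ A v v := fun v hv => hasymm v v hv hv
  unfold GammaFree at hG
  obtain ⟨_, _, h1⟩ := h1
  obtain ⟨_, _, h2⟩ := h2
  replace hxz := hxz.resolve_left hxz'
  replace hyz := hyz.resolve_left hyz'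
  have : m < x := by order
  have : m < y := by order
  wlog h : x < y generalizing x y
  · rcases eq_or_lt_of_not_gt h with rfl | h
    · rfl
    · symm; apply this <;> assumption
  rcases hmz.eq_or_lt with rfl | hmz
  · grind
  replace hmz' := hmz'.resolve_left hmz.ne
  rcases hpz with rfl | hpz
  · grind
  rcases lt_trichotomy p z with hp | rfl | hp
  · rcases lt_or_gt_of_ne hxz' with hx | hx
    · rcases lt_or_gt_of_ne hyz' with hy | hy <;> grind
    · have : z < y := by order
      grind
  · grind
  · have : z < y := by order
    have : z < x := by order
    grind

theorem false_of_min_lt_min (hG : GammaFree A) (hasymm : ∀ u v, A u v → ¬ A v u) {x y p c q : V}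
    (h1 : SortedTriangle A x p c) (h2 : SortedTriangle A p y q ∨ SortedTriangle A p q y)
    (hxy : ¬ A x y) (hyx : ¬ A y x) (hcy : Linked A c y) (hqx : Linked A q x)
    (hcq : Linked A c q) (hcq' : c ≠ q) : False := by
  have hpy : p < y := by rcases h2 with ⟨_, _, _⟩ | ⟨_, _, _⟩ <;> order
  have hpq : p < q := by rcases h2 with ⟨_, _, _⟩ | ⟨_, _, _⟩ <;> order
  replace h2 : (A p y ∧ A y q ∧ A q p) ∨ (A p q ∧ A q y ∧ A y p) := by
    grind [SortedTriangle]
  obtain ⟨_, _, h1⟩ := h1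
  have hirr : ∀ v, ¬ A v v := fun v hv => hasymm v v hv hv
  unfold GammaFree at hG
  have : x < c := by order
  have : x < y := by order
  have : x < q := by order
  replace hcq := hcq.resolve_left hcq'
  replace hqx := hqx.resolve_left (by order)
  replace hcy := hcy.resolve_left (by grind)
  have : c < y ∨ y < c := by grind
  have : c < q ∨ q < c := by grind
  have : y < q ∨ q < y := by grind
  grind

theorem false_of_min_lt_min_of_common (hG : GammaFree A) (hasymm : ∀ u v, A u v → ¬ A v u)
    {x y p b c : V} (h1 : SortedTriangle A x b c) (hxp : x < p) (hpb : p < b)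
    (h2 : SortedTriangle A p y c ∨ SortedTriangle A p c y)
    (hxy : ¬ A x y) (hyx : ¬ A y x) (hby : Linked A b y) (hqx : Linked A p x)
    (hbp : Linked A b p) : False := by
  have hpy : p < y := by rcases h2 with ⟨_, _, _⟩ | ⟨_, _, _⟩ <;> order
  replace h2 : (A p y ∧ A y c ∧ A c p) ∨ (A p c ∧ A c y ∧ A y p) := by
    grind [SortedTriangle]
  obtain ⟨_, _, h1⟩ := h1
  have hirr : ∀ v, ¬ A v v := fun v hv => hasymm v v hv hv
  unfold GammaFree at hG
  have : x < c := by order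
  have : p < c := by order
  have : x < y := by order
  replace hqx := hqx.resolve_left hxp.ne'
  replace hbp := hbp.resolve_left hpb.ne'
  replace hby := hby.resolve_left (by grind)
  have : b < y ∨ y < b := by grind
  have : c < y ∨ y < c := by grind
  grind

theorem false_of_top_lt (hG : GammaFree A) (hasymm : ∀ u v, A u v → ¬ A v u) {x y b c d : V}
    (h1 : SortedTriangle A x b c) (h2 : SortedTriangle A y b d) (h3 : SortedTriangle A y c d)
    (hxd : Linked A x d) : False := by
  obtain ⟨_, _, h1⟩ := h1
  obtain ⟨_, _, h2⟩ := h2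
  obtain ⟨_, _, h3⟩ := h3
  have hirr : ∀ v, ¬ A v v := fun v hv => hasymm v v hv hv
  unfold GammaFree at hG
  have : x < c := by order
  have : x < d := by order
  replace hxd := hxd.resolve_left (by order)
  have : x < y ∨ y < x ∨ x = y := by grind
  grind

theorem twin_of_common_mid_max (hG : GammaFree A) (hasymm : ∀ u v, A u v → ¬ A v u)
    {x y b c z : V} (h1 : SortedTriangle A x b c) (h2 : SortedTriangle A y b c)
    (hx : x < z) (hy : y < z) (hxy : ¬ A x y) (hyx : ¬ A y x) (hbz : Linked A b z)
    (hcz : Linked A c z) (hxz : Linked A x z) (hyz : Linked A y z) : (A x z ↔ A y z) := by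
  obtain ⟨_, _, h1⟩ := h1
  obtain ⟨_, _, h2⟩ := h2
  have hirr : ∀ v, ¬ A v v := fun v hv => hasymm v v hv hv
  unfold GammaFree at hG
  have : x < c := by order
  have : y < c := by order
  replace hxz := hxz.resolve_left hx.ne
  replace hyz := hyz.resolve_left hy.ne
  unfold Linked at *
  wlog hlt : x < y generalizing x y
  · rcases eq_or_lt_of_not_gt hlt with rfl | h
    · rfl
    · symm; apply this <;> assumption
  have : b < z ∨ z < b ∨ z = b := by grind
  have : c < z ∨ z < c ∨ z = c := by grind
  grind

/-- The case of a common minimum. -/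
theorem twin_of_common_min (hG : GammaFree A) (hasymm : ∀ u v, A u v → ¬ A v u)
    {m x y p q z : V} (hxy : ¬ A x y) (hyx : ¬ A y x)
    (hL : ∀ u v, (u = x ∧ v = y) ∨ (u = y ∧ v = x) ∨ Linked A u v)
    (h1 : SortedTriangle A m x p ∨ SortedTriangle A m p x)
    (h2 : SortedTriangle A m y q ∨ SortedTriangle A m q y) (hpq : p ≠ q)
    (hzx : z ≠ x) (hzy : z ≠ y) (hmz : m ≤ z) : A x z ↔ A y z := by
  have hpy : p ≠ y := by grind [SortedTriangle]
  have hqx : q ≠ x := by grind [SortedTriangle]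
  have hqy : q ≠ y := by grind [SortedTriangle]
  have hpx : p ≠ x := by grind [SortedTriangle]
  have hmx : m ≠ x := by grind [SortedTriangle]
  have hmy : m ≠ y := by grind [SortedTriangle]
  replace h1 : SortedTriangle A m p x := h1.resolve_left fun h =>
    h.false_of_common_min hG hasymm h2 hpq hxy hyx (by grind) (by grind) (by grind)
  replace h2 : SortedTriangle A m q y := h2.resolve_left fun h =>
    h.false_of_common_min hG hasymm (.inr h1) hpq.symm hyx hxy (by grind) (by grind) (by grind)
  obtain ⟨h1a, h1b, _⟩ := id h1
  obtain ⟨h2a, h2b, _⟩ := id h2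
  rcases lt_or_gt_of_ne hpq with h | h
  · have h3 := h2.replace_mid hG hasymm (d := p) (by order) (by order) (by grind) (by grind)
      (by grind)
    exact h1.twin_of_common_min_mid hG hasymm h3 hmz hxy hyx hzx.symm hzy.symm
      (by grind) (by grind) (by grind) (by grind)
  · have h3 := h1.replace_mid hG hasymm (d := q) (by order) (by order) (by grind) (by grind)
      (by grind)
    exact h3.twin_of_common_min_mid hG hasymm h2 hmz hxy hyx hzx.symm hzy.symm
      (by grind) (by grind) (by grind) (by grind)

/-- The case where exactly one of the triangles has its non-adjacent vertex as minimum. -/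
theorem false_of_min_of_not_min (hG : GammaFree A) (hasymm : ∀ u v, A u v → ¬ A v u)
    {x y b c p q : V} (hxy : ¬ A x y) (hyx : ¬ A y x)
    (hL : ∀ u v, (u = x ∧ v = y) ∨ (u = y ∧ v = x) ∨ Linked A u v)
    (h1 : SortedTriangle A x b c)
    (h2 : SortedTriangle A p y q ∨ SortedTriangle A p q y)
    (hpc : ¬ (p = b ∧ q = c)) : False := by
  have hpy : p ≠ y := by grind [SortedTriangle]
  have hpx : p ≠ x := by grind [SortedTriangle]
  have hqy : q ≠ y := by grind [SortedTriangle]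
  have hqx : q ≠ x := by grind [SortedTriangle]
  have hby : b ≠ y := by grind [SortedTriangle]
  have hcy : c ≠ y := by grind [SortedTriangle]
  have hbx : b ≠ x := by grind [SortedTriangle]
  have hcx : c ≠ x := by grind [SortedTriangle]
  have hxp : x ≤ p := h1.min_le hG hasymm (by grind) (by grind) (by grind)
  have hpb : p ≤ b := by
    rcases h2 with h2 | h2 <;>
    exact h2.min_le hG hasymm (by grind) (by grind) (by grind)
  obtain ⟨hxb, hbc, _⟩ := id h1
  rcases hpb.eq_or_lt with rfl | hpb
  · exact h1.false_of_min_lt_min hG hasymm h2 hxy hyx (by grind) (by grind) (by grind)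
      (by grind)
  · have h3 := h1.replace_mid hG hasymm (d := p) (by order) (by order) (by grind) (by grind)
      (by grind)
    by_cases hcq : c = q
    · subst hcq
      exact h1.false_of_min_lt_min_of_common hG hasymm (by order) hpb h2 hxy hyx
        (by grind) (by grind) (by grind)
    · exact h3.false_of_min_lt_min hG hasymm h2 hxy hyx (by grind) (by grind) (by grind) hcq

/-- The case where both triangles have their non-adjacent vertex as minimum. -/
theorem twin_of_min_of_min (hG : GammaFree A) (hasymm : ∀ u v, A u v → ¬ A v u)
    {x y b c b' c' z : V} (hxy : ¬ A x y) (hyx : ¬ A y x)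
    (hL : ∀ u v, (u = x ∧ v = y) ∨ (u = y ∧ v = x) ∨ Linked A u v)
    (h1 : SortedTriangle A x b c) (h2 : SortedTriangle A y b' c')
    (hzx : z ≠ x) (hzy : z ≠ y) : A x z ↔ A y z := by
  wlog hcc : c ≤ c' generalizing x y b c b' c'
  · exact (this hyx hxy (by grind) h2 h1 hzy hzx (by order)).symm
  have hby : b ≠ y := by grind [SortedTriangle]
  have hcy : c ≠ y := by grind [SortedTriangle]
  have hbx' : b' ≠ x := by grind [SortedTriangle]
  have hcx' : c' ≠ x := by grind [SortedTriangle]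
  obtain ⟨hxb, hbc, _⟩ := id h1
  obtain ⟨hyb', hbc', _⟩ := id h2
  have hxz : x ≤ z := h1.min_le hG hasymm (by grind) (by grind) (by grind)
  have hyz : y ≤ z := h2.min_le hG hasymm (by grind) (by grind) (by grind)
  have hyb : y ≤ b := h2.min_le hG hasymm (by grind) (by grind) (by grind)
  have h3 := h2.replace_mid hG hasymm (d := b) (by order) (by order) (by grind) (by grind)
      (by grind)
  rcases hcc.eq_or_lt with rfl | hcc
  · exact h1.twin_of_common_mid_max hG hasymm h3 (by order) (by order) hxy hyx
      (by grind) (by grind) (by grind) (by grind)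
  · have h4 := h2.replace_mid hG hasymm (d := c) (by order) (by order) (by grind) (by grind)
      (by grind)
    exact (h1.false_of_top_lt hG hasymm h3 h4 (by grind)).elim

/-- Directed triangles through `x` and through `y` which share at most one vertex force the
non-adjacent vertices `x` and `y` to have the same out-neighbours. -/
theorem twin_of_mem (hG : GammaFree A) (hasymm : ∀ u v, A u v → ¬ A v u)
    {x y a b c a' b' c' z : V} (hne : x ≠ y) (hxy : ¬ A x y) (hyx : ¬ A y x)
    (hL : ∀ u v, (u = x ∧ v = y) ∨ (u = y ∧ v = x) ∨ Linked A u v)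
    (h1 : SortedTriangle A a b c) (h2 : SortedTriangle A a' b' c')
    (hx : x = a ∨ x = b ∨ x = c) (hy : y = a' ∨ y = b' ∨ y = c')
    (hdisj : ∀ u v, u ≠ v → (u = a ∨ u = b ∨ u = c) → (v = a ∨ v = b ∨ v = c) →
      (u = a' ∨ u = b' ∨ u = c') → ¬ (v = a' ∨ v = b' ∨ v = c'))
    (hzx : z ≠ x) (hzy : z ≠ y) : A x z ↔ A y z := by
  obtain ⟨hab, hbc, _⟩ := id h1
  obtain ⟨hab', hbc', _⟩ := id h2
  have hL' : ∀ u v, (u = y ∧ v = x) ∨ (u = x ∧ v = y) ∨ Linked A u v := by grind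
  have key1 : a = x ∨ ∃ p, (p = b ∨ p = c) ∧
      (SortedTriangle A a x p ∨ SortedTriangle A a p x) := by
    rcases hx with rfl | rfl | rfl
    exacts [.inl rfl, .inr ⟨c, .inr rfl, .inl h1⟩, .inr ⟨b, .inl rfl, .inr h1⟩]
  have key2 : a' = y ∨ ∃ q, (q = b' ∨ q = c') ∧
      (SortedTriangle A a' y q ∨ SortedTriangle A a' q y) := by
    rcases hy with rfl | rfl | rfl
    exacts [.inl rfl, .inr ⟨c', .inr rfl, .inl h2⟩, .inr ⟨b', .inl rfl, .inr h2⟩]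
  rcases key1 with rfl | ⟨p, hp, h1'⟩ <;> rcases key2 with rfl | ⟨q, hq, h2'⟩
  · exact h1.twin_of_min_of_min hG hasymm hxy hyx hL h2 hzx hzy
  · exact (h1.false_of_min_of_not_min hG hasymm hxy hyx hL h2' (by grind)).elim
  · exact (h2.false_of_min_of_not_min hG hasymm hyx hxy hL' h1' (by grind)).elim
  · have hya : ¬ (y = a ∨ y = b ∨ y = c) := by grind [SortedTriangle]
    have hxa' : ¬ (x = a' ∨ x = b' ∨ x = c') := by grind [SortedTriangle]
    have hax : a ≠ x := by grind [SortedTriangle]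
    have hay' : a' ≠ y := by grind [SortedTriangle]
    have h : a ≤ a' := h1.min_le hG hasymm (by grind) (by grind) (by grind)
    have h' : a' ≤ a := h2.min_le hG hasymm (by grind) (by grind) (by grind)
    obtain rfl := le_antisymm h h'
    exact twin_of_common_min hG hasymm hxy hyx hL h1' h2' (by grind) hzx hzy
      (h1.min_le hG hasymm (by grind) (by grind) (by grind))

/-- Fully linked directed triangles share their minimum and their maximum. -/
theorem eq_and_eq_of_linked (hG : GammaFree A) (hasymm : ∀ u v, A u v → ¬ A v u)
    {a b c a' b' c' : V} (h1 : SortedTriangle A a b c) (h2 : SortedTriangle A a' b' c')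
    (hL : ∀ u v, (u = a ∨ u = b ∨ u = c) → (v = a' ∨ v = b' ∨ v = c') → Linked A u v) :
    a = a' ∧ c = c' := by
  have hsymm : ∀ u v, Linked A u v → Linked A v u := by grind [Linked]
  have h : a ≤ a' := h1.min_le hG hasymm (by grind) (by grind) (by grind)
  have h' : a' ≤ a := h2.min_le hG hasymm (by grind) (by grind) (by grind)
  obtain rfl := le_antisymm h h'
  exact ⟨rfl, h1.max_eq hG hasymm h2 (by grind) (by grind) (by grind) (by grind)⟩

end SortedTriangle

theorem DirTriangle.exists_sortedTriangle {V : Type*} [LinearOrder V] {A : V → V → Prop}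
    {u v w : V} (h : DirTriangle A u v w) :
    ∃ a b c, SortedTriangle A a b c ∧
      ∀ t, (t = a ∨ t = b ∨ t = c) ↔ (t = u ∨ t = v ∨ t = w) := by
  obtain ⟨h1, h2, h3, huv, hvw, hwu⟩ := h
  rcases lt_or_gt_of_ne h1 with h1 | h1 <;> rcases lt_or_gt_of_ne h2 with h2 | h2 <;>
    rcases lt_or_gt_of_ne h3 with h3 | h3
  · order
  · exact ⟨u, v, w, ⟨h1, h2, .inl ⟨huv, hvw, hwu⟩⟩, by tauto⟩
  · exact ⟨w, u, v, ⟨h3, h1, .inl ⟨hwu, huv, hvw⟩⟩, by tauto⟩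
  · exact ⟨u, w, v, ⟨h3, h2, .inr ⟨huv, hvw, hwu⟩⟩, by tauto⟩
  · exact ⟨v, w, u, ⟨h2, h3, .inl ⟨hvw, hwu, huv⟩⟩, by tauto⟩
  · exact ⟨v, u, w, ⟨h1, h3, .inr ⟨hvw, hwu, huv⟩⟩, by tauto⟩
  · exact ⟨w, v, u, ⟨h2, h1, .inr ⟨hwu, huv, hvw⟩⟩, by tauto⟩
  · order

theorem DirTriangle.arc_of_mem {V : Type*} {A : V → V → Prop} {u v w s t : V}
    (h : DirTriangle A u v w) (hst : s ≠ t) (hs : s = u ∨ s = v ∨ s = w)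
    (ht : t = u ∨ t = v ∨ t = w) :
    (A s t ∧ ((s = u ∧ t = v) ∨ (s = v ∧ t = w) ∨ (s = w ∧ t = u))) ∨
      (A t s ∧ ((t = u ∧ s = v) ∨ (t = v ∧ s = w) ∨ (t = w ∧ s = u))) := by
  obtain ⟨-, -, -, huv, hvw, hwu⟩ := h
  rcases hs with rfl | rfl | rfl <;> rcases ht with rfl | rfl | rfl <;> simp_all

/-- Let `D` (arc relation `A`) be obtained from an irreflexive tournament by deleting
the arc `(x,y)`: `x` and `y` are distinct non-adjacent vertices and every other pair
of distinct vertices has exactly one arc. If `x` and `y` are not false twins in `D`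
and `D` contains two arc-disjoint directed triangles, then `D` is not strongly
chordal. -/
theorem stmt_15 {V : Type*} [Fintype V] (A : V → V → Prop) (x y : V)
    (hxy : x ≠ y)
    (hirr : ∀ v : V, ¬ A v v)
    (hnonadj : ¬ A x y ∧ ¬ A y x)
    (htour : ∀ u v : V, u ≠ v → ¬ (u = x ∧ v = y) → ¬ (u = y ∧ v = x) →
      (A u v ↔ ¬ A v u))
    (htwin : ¬ ∀ z : V, (A z x ↔ A z y) ∧ (A x z ↔ A y z))
    (htri : ∃ u v w a b c : V, DirTriangle A u v w ∧ DirTriangle A a b c ∧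
      ({(u, v), (v, w), (w, u)} : Set (V × V)) ∩ {(a, b), (b, c), (c, a)} = ∅) :
    ¬ StronglyChordal A := by
  rintro ⟨r, hr, hS⟩
  classical
  let _ : LinearOrder V := linearOrderOfSTO r
  have hG : GammaFree A := hS
  have hasymm : ∀ u v, A u v → ¬ A v u := by
    intro u v h h'
    rcases eq_or_ne u v with rfl | huv
    · exact hirr _ h
    · exact (htour u v huv (by rintro ⟨rfl, rfl⟩; exact hnonadj.1 h)
        (by rintro ⟨rfl, rfl⟩; exact hnonadj.2 h)).1 h h'
  have hL : ∀ u v, (u = x ∧ v = y) ∨ (u = y ∧ v = x) ∨ Linked A u v := by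
    intro u v
    have := htour u v
    unfold Linked
    tauto
  obtain ⟨u, v, w, a, b, c, h1, h2, harc⟩ := htri
  have hdisj : ∀ s t, s ≠ t → (s = u ∨ s = v ∨ s = w) → (t = u ∨ t = v ∨ t = w) →
      (s = a ∨ s = b ∨ s = c) → ¬ (t = a ∨ t = b ∨ t = c) := by
    have harc' : ∀ s t, ((s = u ∧ t = v) ∨ (s = v ∧ t = w) ∨ (s = w ∧ t = u)) →
        ¬ ((s = a ∧ t = b) ∨ (s = b ∧ t = c) ∨ (s = c ∧ t = a)) := by
      intro s t h h'
      have : (s, t) ∈ ({(u, v), (v, w), (w, u)} : Set (V × V)) ∩ {(a, b), (b, c), (c, a)} := by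
        simpa using ⟨h, h'⟩
      simp [harc] at this
    intro s t hst hs ht hs' ht'
    rcases h1.arc_of_mem hst hs ht with ⟨h, e⟩ | ⟨h, e⟩ <;>
      rcases h2.arc_of_mem hst hs' ht' with ⟨h', e'⟩ | ⟨h', e'⟩
    · exact harc' _ _ e e'
    · exact hasymm _ _ h h'
    · exact hasymm _ _ h h'
    · exact harc' _ _ e e'
  obtain ⟨a₁, b₁, c₁, t1, m1⟩ := h1.exists_sortedTriangle
  obtain ⟨a₂, b₂, c₂, t2, m2⟩ := h2.exists_sortedTriangle
  simp only [← m1, ← m2] at hdisj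
  clear m1 m2 h1 h2 harc
  have hout : ∀ z, z ≠ x → z ≠ y → (A x z ↔ A y z) := by
    intro z hzx hzy
    by_cases hxy' : (x = a₁ ∨ x = b₁ ∨ x = c₁) ∧ (y = a₂ ∨ y = b₂ ∨ y = c₂)
    · exact t1.twin_of_mem hG hasymm hxy hnonadj.1 hnonadj.2 hL t2 hxy'.1 hxy'.2 hdisj hzx hzy
    by_cases hyx' : (x = a₂ ∨ x = b₂ ∨ x = c₂) ∧ (y = a₁ ∨ y = b₁ ∨ y = c₁)
    · exact t2.twin_of_mem hG hasymm hxy hnonadj.1 hnonadj.2 hL t1 hyx'.1 hyx'.2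
        (by intro s t h i j k l; exact hdisj s t h k l i j) hzx hzy
    have ⟨e, e'⟩ := t1.eq_and_eq_of_linked hG hasymm t2 (by grind)
    exact (hdisj a₁ c₁ (t1.1.trans t1.2.1).ne (by simp) (by simp) (by simp [e])
      (by simp [e'])).elim
  exact htwin fun z => by
    by_cases hzx : z = x
    · subst hzx; simp [hirr, hnonadj]
    by_cases hzy : z = y
    · subst hzy; simp [hirr, hnonadj]
    have := hout z hzx hzy
    exact ⟨by rw [htour z x hzx (by tauto) (by tauto), htour z y hzy (by tauto) (by tauto), this],
      this⟩
end

section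
/- Let D be the digraph obtained from an irreflexive tournament T by deleting one arc (x,y). If T − y is strongly chordal and y is a false twin of x in D, then D is strongly chordal. -/
/-- Pulling a strong ordering back along `f`, with the fibres of `f` ordered by `t`. -/
theorem StronglyChordal.comap {V W : Type*} {A : W → W → Prop} (h : StronglyChordal A)
    (f : V → W) : StronglyChordal (fun u v => A (f u) (f v)) := by
  obtain ⟨r, hr, hs⟩ := h
  let t : V → V → Prop := WellOrderingRel
  have htri : ∀ a b : V, t a b ∨ a = b ∨ t b a := fun a b => trichotomous_of t a b
  have hrtri : ∀ a b : W, r a b ∨ a = b ∨ r b a := fun a b => trichotomous_of r a b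
  have hirr : ∀ a : V, ¬ t a a := fun a => irrefl_of t a
  have hrirr : ∀ a : W, ¬ r a a := fun a => irrefl_of r a
  have htrans : ∀ {a b c : V}, t a b → t b c → t a c := fun h₁ h₂ => trans_of t h₁ h₂
  have hrtrans : ∀ {a b c : W}, r a b → r b c → r a c := fun h₁ h₂ => trans_of r h₁ h₂
  refine ⟨fun a b => r (f a) (f b) ∨ f a = f b ∧ t a b,
    { trichotomous := ?_, irrefl := ?_, trans := ?_ }, ?_⟩
  · intro a b h₁ h₂
    grind
  · grind
  · intro a b c h₁ h₂
    grind
  · intro a b c d h₁ h₂ hac had hbc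
    rcases h₁ with h₁ | ⟨h₁, -⟩
    · rcases h₂ with h₂ | ⟨h₂, -⟩
      · exact hs _ _ _ _ h₁ h₂ hac had hbc
      · exact h₂ ▸ hbc
    · exact h₁ ▸ had

/-- Let `D` be obtained from an irreflexive tournament `T` (arc relation `A`) by
deleting the arc `(x,y)`. If `T − y` is strongly chordal and `y` is a false twin of
`x` in `D`, then `D` is strongly chordal. -/
theorem stmt_16 {V : Type*} [Fintype V] (A : V → V → Prop) (x y : V)
    (hxy : x ≠ y)
    (hirr : ∀ v : V, ¬ A v v)
    (htour : ∀ u v : V, u ≠ v → (A u v ↔ ¬ A v u))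
    (harc : A x y)
    (D : V → V → Prop)
    (hD : ∀ u v : V, D u v ↔ (A u v ∧ ¬ (u = x ∧ v = y)))
    (hTy : StronglyChordal (fun u v : {z : V // z ≠ y} => A u.val v.val))
    (htwin : ∀ z : V, (D z x ↔ D z y) ∧ (D x z ↔ D y z)) :
    StronglyChordal D := by
  classical
  let f : V → {z : V // z ≠ y} := fun v => if h : v = y then ⟨x, hxy⟩ else ⟨v, h⟩
  have hf : D = fun u v => A (f u).val (f v).val := by
    ext u v
    have hDne : ∀ u v : V, v ≠ y → (D u v ↔ A u v) := by grind
    by_cases hu : u = y <;> by_cases hv : v = y <;> simp only [f, hu, hv, dite_true, dite_false]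
    · rw [← (htwin y).1, ← (htwin x).2, hDne x x hxy]
    · rw [← (htwin v).2, hDne x v hv]
    · rw [← (htwin u).1, hDne u x hxy]
    · rw [hDne u v hv]
  rw [hf]
  exact hTy.comap f
end

section
/- Let D be a reflexive multipartite tournament. If D is strongly chordal, then its underlying undirected graph (ignoring loops) is a complete split graph. -/
/-- In a strong ordering, a vertex cannot precede two distinct vertices of another common part. -/
theorem StrongOrdering.not_rel_and_rel {V P : Type*} {A r : V → V → Prop} {part : V → P}
    (hr : StrongOrdering A r) (href : ∀ v : V, A v v)
    (hsame : ∀ u v : V, u ≠ v → part u = part v → ¬ A u v)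
    (hdiff : ∀ u v : V, u ≠ v → part u ≠ part v → (A u v ↔ ¬ A v u))
    {x y z : V} (hyz : y ≠ z) (hpart : part y = part z) (hx : part x ≠ part y) :
    ¬ (r x y ∧ r x z) := by
  obtain ⟨hord, hstrong⟩ := hr
  rintro ⟨hxy, hxz⟩
  have adj {v : V} (hv : part x ≠ part v) : A x v ∨ A v x := by
    by_cases h : A x v
    · exact Or.inl h
    · exact Or.inr ((hdiff v x (fun e => hv (e ▸ rfl)) hv.symm).2 h)
  have nyz := hsame y z hyz hpart
  have nzy := hsame z y hyz.symm hpart.symm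
  rcases adj hx with h1 | h1 <;> rcases adj (hpart ▸ hx) with h2 | h2
  · rcases trichotomous_of r y z with h | h | h
    · exact nyz (hstrong x y y z hxy h h1 h2 (href y))
    · exact hyz h
    · exact nzy (hstrong x z z y hxz h h2 h1 (href z))
  · exact nzy (hstrong x z x y hxz hxy (href x) h1 h2)
  · exact nyz (hstrong x y x z hxy hxz (href x) h2 h1)
  · rcases trichotomous_of r y z with h | h | h
    · exact nzy (hstrong y z x y h hxy h1 (href y) h2)
    · exact hyz h
    · exact nyz (hstrong z y x z h hxz h2 (href z) h1)

/-- If a reflexive multipartite tournament (parts given by `part`) is strongly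
chordal, then its underlying undirected graph (ignoring loops) is a complete split
graph: the vertex set splits into a clique `T` and an independent set `S = Tᶜ` with
every vertex of `S` adjacent to every vertex of `T`. -/
theorem stmt_17 {V : Type*} [Fintype V] {P : Type*} (A : V → V → Prop)
    (part : V → P)
    (href : ∀ v : V, A v v)
    (hsame : ∀ u v : V, u ≠ v → part u = part v → ¬ A u v)
    (hdiff : ∀ u v : V, u ≠ v → part u ≠ part v → (A u v ↔ ¬ A v u))
    (hsc : StronglyChordal A) :
    ∃ T : Set V,
      (∀ u ∈ T, ∀ v ∈ T, u ≠ v → (A u v ∨ A v u)) ∧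
      (∀ u ∉ T, ∀ v ∉ T, u ≠ v → ¬ (A u v ∨ A v u)) ∧
      (∀ s ∉ T, ∀ t ∈ T, A s t ∨ A t s) := by
  obtain ⟨r, hr⟩ := hsc
  have key := fun x y z => hr.not_rel_and_rel href hsame hdiff (x := x) (y := y) (z := z)
  have hord := hr.1
  have tri := fun a b : V => trichotomous_of r a b
  have tr : ∀ a b c : V, r a b → r b c → r a c := fun _ _ _ => _root_.trans
  have adj : ∀ u v : V, part u ≠ part v → A u v ∨ A v u := by
    intro u v h
    have := hdiff u v (fun e => h (e ▸ rfl)) h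
    tauto
  refine ⟨{t | ∀ v, part v = part t → v = t}, ?_, ?_, ?_⟩
  · exact fun u _ v hv huv => adj u v fun h => huv (hv u h)
  · intro u hu v hv huv
    suffices h : part u = part v by
      exact not_or.2 ⟨hsame u v huv h, hsame v u huv.symm h.symm⟩
    by_contra h
    simp only [Set.mem_ofPred_eq, not_forall] at hu hv
    obtain ⟨u', hu', hne⟩ := hu
    obtain ⟨v', hv', hne'⟩ := hv
    have h1 := key u v v' (Ne.symm hne') hv'.symm h
    have h2 := key u' v v' (Ne.symm hne') hv'.symm (hu' ▸ h)
    have h3 := key v u u' (Ne.symm hne) hu'.symm (Ne.symm h)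
    have h4 := key v' u u' (Ne.symm hne) hu'.symm (hv' ▸ Ne.symm h)
    grind
  · exact fun s hs t ht => adj s t fun h => hs (ht s h ▸ ht)
end

section
/- Let D be a strongly chordal digraph in which every vertex has at least one in-neighbour. Then the minimum size of a dominating set of D equals the maximum size of a set of vertices of D whose in-neighbourhoods are pairwise disjoint. -/
/-- `S` is a dominating set: every vertex has an in-neighbour in `S`. -/
def DominatingSet {V : Type*} (A : V → V → Prop) (S : Set V) : Prop :=
  ∀ v : V, ∃ u ∈ S, A u v

/-- The in-neighbourhoods of the vertices in `C` are pairwise disjoint. -/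
def DisjointInNbhds {V : Type*} (A : V → V → Prop) (C : Set V) : Prop :=
  ∀ x ∈ C, ∀ y ∈ C, x ≠ y → {u : V | A u x} ∩ {u : V | A u y} = ∅

theorem DisjointInNbhds.ncard_le_ncard {V : Type*} [Finite V] {A : V → V → Prop} {C S : Set V}
    (hC : DisjointInNbhds A C) (hS : DominatingSet A S) : C.ncard ≤ S.ncard := by
  choose f hfS hf using hS
  refine Set.ncard_le_ncard_of_injOn f (fun v _ => hfS v) ?_ S.toFinite
  intro x hx y hy hxy
  by_contra hne
  have hmem : f x ∈ {u : V | A u x} ∩ {u : V | A u y} := ⟨hf x, by simpa [hxy] using hf y⟩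
  simp [hC x hx y hy hne] at hmem

/-- In a strong ordering, the largest in-neighbour of `v` dominates `v` and every later vertex
whose in-neighbourhood meets that of `v`. -/
theorem StrongOrdering.exists_dominator {V : Type*} [Finite V] {A r : V → V → Prop}
    (hr : StrongOrdering A r) {v : V} (hin : ∃ u : V, A u v) :
    ∃ m : V, A m v ∧ ∀ u w : V, r v w → A u v → A u w → A m w := by
  have := hr.1
  let _ : LinearOrder V := by classical exact linearOrderOfSTO r
  obtain ⟨m, hm, hle⟩ := Set.exists_max_image {u | A u v} id (Set.toFinite _) hin
  refine ⟨m, hm, fun u w hvw huv huw => ?_⟩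
  rcases (hle u huv).eq_or_lt with h | h
  · exact (show u = m from h) ▸ huw
  · exact hr.2 u m v w h hvw huv huw hm

/-- The greedy construction: scanning the vertices along the ordering, keep each vertex that is
not yet dominated. -/
theorem StrongOrdering.exists_disjointInNbhds_dominatingSet {V : Type*} [Fintype V]
    {A r : V → V → Prop} (hr : StrongOrdering A r) (hin : ∀ v : V, ∃ u : V, A u v) :
    ∃ C S : Set V, DisjointInNbhds A C ∧ DominatingSet A S ∧ S.ncard ≤ C.ncard := by
  classical
  choose m hm hdom using fun v => hr.exists_dominator (hin v)
  have := hr.1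
  let _ : LinearOrder V := linearOrderOfSTO r
  suffices h : ∀ T : Finset V, ∃ C : Set V, C ⊆ T ∧ DisjointInNbhds A C ∧
      ∀ v ∈ T, ∃ c ∈ C, A (m c) v by
    obtain ⟨C, -, hC, hS⟩ := h Finset.univ
    refine ⟨C, m '' C, hC, fun v => ?_, Set.ncard_image_le C.toFinite⟩
    simpa using hS v (Finset.mem_univ v)
  intro T
  induction T using Finset.induction_on_max with
  | empty => exact ⟨∅, by simp, by simp [DisjointInNbhds], by simp⟩
  | insert x T hx ih =>
    obtain ⟨C, hCT, hC, hS⟩ := ih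
    by_cases hxC : ∃ c ∈ C, A (m c) x
    · exact ⟨C, fun c hc => by simp [Finset.mem_coe.1 (hCT hc)], hC,
        Finset.forall_mem_insert _ _ _ |>.2 ⟨hxC, hS⟩⟩
    · have hnew : ∀ c ∈ C, ∀ u, A u c → ¬ A u x := fun c hc u huc hux =>
        hxC ⟨c, hc, hdom c u x (hx c (hCT hc)) huc hux⟩
      refine ⟨insert x C, by simpa using Set.insert_subset_insert hCT, ?_,
        Finset.forall_mem_insert _ _ _ |>.2 ⟨⟨x, Set.mem_insert x C, hm x⟩, fun v hv => ?_⟩⟩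
      · rintro y (rfl | hy) z (rfl | hz) hyz
        · exact absurd rfl hyz
        · exact Set.eq_empty_of_forall_notMem fun u hu => hnew z hz u hu.2 hu.1
        · exact Set.eq_empty_of_forall_notMem fun u hu => hnew y hy u hu.1 hu.2
        · exact hC y hy z hz hyz
      · obtain ⟨c, hc, hcv⟩ := hS v hv
        exact ⟨c, Set.mem_insert_of_mem x hc, hcv⟩

/-- In a strongly chordal digraph in which every vertex has an in-neighbour, the
minimum size of a dominating set equals the maximum size of a set of vertices with
pairwise disjoint in-neighbourhoods. -/
theorem stmt_19 {V : Type*} [Fintype V] (A : V → V → Prop)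
    (hsc : StronglyChordal A)
    (hin : ∀ v : V, ∃ u : V, A u v) :
    sInf {n : ℕ | ∃ S : Set V, DominatingSet A S ∧ S.ncard = n} =
      sSup {n : ℕ | ∃ C : Set V, DisjointInNbhds A C ∧ C.ncard = n} := by
  obtain ⟨r, hr⟩ := hsc
  obtain ⟨C, S, hC, hS, hSC⟩ := hr.exists_disjointInNbhds_dominatingSet hin
  have hCS : C.ncard = S.ncard := (hC.ncard_le_ncard hS).antisymm hSC
  have hmin : IsLeast {n : ℕ | ∃ S : Set V, DominatingSet A S ∧ S.ncard = n} S.ncard :=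
    ⟨⟨S, hS, rfl⟩, by rintro _ ⟨S', hS', rfl⟩; exact hCS ▸ hC.ncard_le_ncard hS'⟩
  have hmax : IsGreatest {n : ℕ | ∃ C : Set V, DisjointInNbhds A C ∧ C.ncard = n} S.ncard :=
    ⟨⟨C, hC, hCS⟩, by rintro _ ⟨C', hC', rfl⟩; exact hC'.ncard_le_ncard hS⟩
  rw [hmin.csInf_eq, hmax.csSup_eq]
end
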